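/- arXiv:2203.06205 — 2 statements merged into one kernel-verified Lean document; each statement's English description precedes it below -/
import Mathlib

section
/- Let q be a prime power and F_q the finite field with q elements. Let d > 1 be an integer and let α_1, …, α_d ∈ F_q[t] be distinct polynomials such that for each pair i ≠ j the inequality deg(α_i − α_j) + Σ_{ℓ ≠ j} deg(α_ℓ − α_j) > max_ℓ deg(α_ℓ) holds. For σ in a field containing F_q[σ], set f_σ(z) = (z − α_1(σ))···(z − α_d(σ)). Then for every field k containing F_q, every function field K over k, and every integer D ≥ 1, there exists a bound B (depending only on the family, k, K, and D) such that: for every field extension L/K with [L : K] ≤ D and every σ ∈ L for which f_σ ∈ L[z] is not isotrivial over k, the number of preperiodic points of f_σ in P¹(L) is at most B. -/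
open Polynomial

/-- A point is preperiodic for a self-map if its forward orbit is finite. -/
def IsPreperiodic {S : Type*} (f : S → S) (x : S) : Prop :=
  (Set.range fun n : ℕ => f^[n] x).Finite

/-- The action of a polynomial on `P¹(L) = L ∪ {∞}`, with `none` playing the role of `∞`. -/
def polyP1Map {L : Type*} [Field L] (f : Polynomial L) : Option L → Option L
  | none => none
  | some x => some (f.eval x)

open scoped Classical in
/-- The self-map of `P¹(F) = F ∪ {∞}` induced by the rational function `p/q`. -/
noncomputable def ratP1Map {F : Type*} [Field F] (p q : Polynomial F) :
    Option F → Option F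
  | none =>
      if q.degree < p.degree then none
      else if p.degree < q.degree then some 0
      else some (p.leadingCoeff / q.leadingCoeff)
  | some x => if q.eval x = 0 then none else some (p.eval x / q.eval x)

/-- The Möbius transformation `z ↦ (az + b)/(cz + d)` as a self-map of `P¹(F)`. -/
noncomputable def mobiusMap {F : Type*} [Field F] (a b c d : F) : Option F → Option F :=
  ratP1Map (C a * X + C b) (C c * X + C d)

/-- `x` is algebraic over the image of `ι`. -/
def AlgebraicOver {k F : Type*} [Field k] [Field F] (ι : k →+* F) (x : F) : Prop :=
  ∃ p : Polynomial k, p ≠ 0 ∧ (p.map ι).IsRoot x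

/-- A self-map `g` of `P¹(F)` is isotrivial over `k` (w.r.t. `ι : k →+* F`, `F` playing the
role of an algebraic closure of `L`) if some Möbius conjugate `γ⁻¹ ∘ g ∘ γ` of `g` is given by a
rational function all of whose coefficients are algebraic over `k`. -/
def IsotrivialMap {k F : Type*} [Field k] [Field F] (ι : k →+* F)
    (g : Option F → Option F) : Prop :=
  ∃ a b c d : F, a * d - b * c ≠ 0 ∧
    ∃ p q : Polynomial F, q ≠ 0 ∧
      (∀ n, AlgebraicOver ι (p.coeff n)) ∧ (∀ n, AlgebraicOver ι (q.coeff n)) ∧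
      (mobiusMap d (-b) (-c) a) ∘ g ∘ (mobiusMap a b c d) = ratP1Map p q

open Polynomial

namespace SUB

section Prague
variable {Om : Type*} [Field Om] {O : Subring Om}

def Cf (O : Subring Om) (p : Om[X]) : Prop := ∀ n, p.coeff n ∈ O

lemma Cf.add {p q : Om[X]} (hp : Cf O p) (hq : Cf O q) : Cf O (p + q) := fun n => by
  rw [coeff_add]; exact O.add_mem (hp n) (hq n)

lemma Cf.sub {p q : Om[X]} (hp : Cf O p) (hq : Cf O q) : Cf O (p - q) := fun n => by
  rw [coeff_sub]; exact O.sub_mem (hp n) (hq n)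

lemma Cf.X_mul {p : Om[X]} (hp : Cf O p) : Cf O (X * p) := fun n => by
  cases n with
  | zero => simp
  | succ n => rw [coeff_X_mul]; exact hp n

lemma Cf.C_mul_X_pow {a : Om} (ha : a ∈ O) (k : ℕ) : Cf O (C a * X ^ k) := fun n => by
  rw [coeff_C_mul_X_pow]; split_ifs
  · exact ha
  · exact O.zero_mem

/-- `O` is integrally closed in `Om`. -/
def IC (O : Subring Om) : Prop := ∀ x : Om, IsIntegral O x → x ∈ O

lemma Cf.root_mul_lead (hO : IC O) {p : Om[X]} (hp : Cf O p) {ρ : Om} (h : p.eval ρ = 0) :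
    p.leadingCoeff * ρ ∈ O := by
  have hl : p ∈ Polynomial.lifts (algebraMap O Om) := by
    rw [Polynomial.lifts_iff_coeff_lifts]
    intro n
    exact ⟨⟨p.coeff n, hp n⟩, rfl⟩
  obtain ⟨P, hP⟩ := (Polynomial.mem_lifts _).1 hl
  have hinj : Function.Injective (algebraMap O Om) := Subtype.val_injective
  have h2 : aeval ρ P = 0 := by
    rw [aeval_def, ← eval_map, hP, h]
  have h3 := isIntegral_leadingCoeff_smul P ρ h2
  have h4 := hO _ h3
  rw [Algebra.smul_def, ← Polynomial.leadingCoeff_map_of_injective hinj, hP] at h4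
  exact h4

lemma Cf.div_root (hO : IC O) (ρ : Om) : ∀ (n : ℕ) (g : Om[X]), g.natDegree ≤ n →
    Cf O ((X - C ρ) * g) → Cf O g := by
  intro n
  induction n with
  | zero =>
    intro g hg h
    have hc := eq_C_of_natDegree_le_zero hg
    rw [hc] at h ⊢
    intro i
    have := h 1
    rw [coeff_mul_C] at this
    simp at this
    rw [coeff_C]; split_ifs
    · exact this
    · exact O.zero_mem
  | succ n ih =>
    intro g hg h
    by_cases hg0 : g = 0
    · subst hg0; intro i; simp
    have hlead : g.leadingCoeff ∈ O := by
      have := h ((X - C ρ) * g).natDegree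
      rw [coeff_natDegree, leadingCoeff_mul, (monic_X_sub_C ρ).leadingCoeff, one_mul] at this
      exact this
    have hlr : g.leadingCoeff * ρ ∈ O := by
      have := Cf.root_mul_lead hO h (ρ := ρ) (by simp)
      rwa [leadingCoeff_mul, (monic_X_sub_C ρ).leadingCoeff, one_mul] at this
    have key : (X - C ρ) * g.eraseLead = (X - C ρ) * g - C g.leadingCoeff * X ^ (g.natDegree + 1)
        + C (g.leadingCoeff * ρ) * X ^ g.natDegree := by
      have := g.eraseLead_add_C_mul_X_pow
      rw [C_mul]
      linear_combination (X - C ρ) * this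
    have h1 : Cf O g.eraseLead := by
      apply ih
      · have := g.eraseLead_natDegree_le; omega
      · rw [key]
        exact (h.sub (Cf.C_mul_X_pow hlead _)).add (Cf.C_mul_X_pow hlr _)
    have := h1.add (Cf.C_mul_X_pow hlead g.natDegree)
    rwa [g.eraseLead_add_C_mul_X_pow] at this

lemma Cf.peel [IsAlgClosed Om] (hO : IC O) : ∀ (n : ℕ) (m : Om[X]), m.Monic → m.natDegree = n →
    ∀ (a : Om) (r : Om[X]), Cf O (C a * (m * r)) → ∀ j, Cf O (C (a * m.coeff j) * r) := by
  intro n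
  induction n with
  | zero =>
    intro m hm hn a r h j
    have : m = 1 := by
      rw [eq_C_of_natDegree_eq_zero hn, ← hn, coeff_natDegree, hm.leadingCoeff, C_1]
    subst this
    rw [coeff_one]; split_ifs
    · simpa using h
    · intro i; simp
  | succ n ih =>
    intro m hm hn a r h j
    have hdeg : m.degree ≠ 0 := by
      rw [degree_eq_natDegree hm.ne_zero, hn]; exact_mod_cast Nat.succ_ne_zero n
    obtain ⟨ρ, hρ⟩ := IsAlgClosed.exists_root m hdeg
    obtain ⟨m', rfl⟩ := dvd_iff_isRoot.2 hρ
    have hm' : m'.Monic := (monic_X_sub_C ρ).of_mul_monic_left hm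
    have hn' : m'.natDegree = n := by
      rw [(monic_X_sub_C ρ).natDegree_mul hm', natDegree_X_sub_C] at hn; omega
    have e1 : (X - C ρ) * (C a * (m' * r)) = C a * ((X - C ρ) * m' * r) := by ring
    have h1 : Cf O (C a * (m' * r)) := Cf.div_root hO ρ _ _ le_rfl (by rw [e1]; exact h)
    have h2 : Cf O (C (a * ρ) * (m' * r)) := by
      have e2 : C (a * ρ) * (m' * r) = X * (C a * (m' * r)) - C a * ((X - C ρ) * m' * r) := by
        rw [C_mul]; ring
      rw [e2]; exact h1.X_mul.sub h
    have h3 := ih m' hm' hn' _ _ h2 j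
    rw [sub_mul]
    cases j with
    | zero =>
      rw [coeff_sub, coeff_C_mul, coeff_X_mul_zero]
      have e : C (a * (0 - ρ * m'.coeff 0)) * r = 0 - C (a * ρ * m'.coeff 0) * r := by
        simp only [C_mul, C_sub, C_0]; ring
      rw [e]
      exact Cf.sub (fun i => by simp) h3
    | succ j =>
      have h4 := ih m' hm' hn' _ _ h1 j
      rw [coeff_sub, coeff_C_mul, coeff_X_mul]
      have e : C (a * (m'.coeff j - ρ * m'.coeff (j + 1))) * r
          = C (a * m'.coeff j) * r - C (a * ρ * m'.coeff (j + 1)) * r := by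
        simp only [C_mul, C_sub]; ring
      rw [e]
      exact h4.sub h3

lemma Cf.peel_prod [IsAlgClosed Om] (hO : IC O) {ι : Type*} (s : Finset ι) (m : ι → Om[X])
    (hm : ∀ i, (m i).Monic) (j : ι → ℕ) : ∀ (a : Om) (r : Om[X]),
    Cf O (C a * ((∏ i ∈ s, m i) * r)) → Cf O (C (a * ∏ i ∈ s, (m i).coeff (j i)) * r) := by
  classical
  induction s using Finset.induction_on with
  | empty => intro a r h; simpa using h
  | insert i s hi ih =>
    intro a r h
    rw [Finset.prod_insert hi, mul_assoc] at h
    have := ih _ _ (Cf.peel hO _ (m i) (hm i) rfl _ _ h (j i))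
    rw [Finset.prod_insert hi, ← mul_assoc]
    exact this

/-- Dedekind's "Prague" theorem, in the form we need. -/
lemma prague [IsAlgClosed Om] (hO : IC O) {ι : Type*} (s : Finset ι) (m : ι → Om[X])
    (hm : ∀ i, (m i).Monic) (j : ι → ℕ) (Q : Om[X]) (hQ : Cf O Q) (hQ0 : Q ≠ 0)
    (hdvd : ∏ i ∈ s, m i ∣ Q) :
    Q.leadingCoeff * ∏ i ∈ s, (m i).coeff (j i) ∈ O := by
  obtain ⟨r, hr⟩ := hdvd
  have hmon : (∏ i ∈ s, m i).Monic := monic_prod_of_monic _ _ (fun i _ => hm i)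
  have hl : Q.leadingCoeff = r.leadingCoeff := by rw [hr, leadingCoeff_mul, hmon.leadingCoeff, one_mul]
  have h := Cf.peel_prod hO s m hm j 1 r (by rw [C_1, one_mul, ← hr]; exact hQ)
  have := h r.natDegree
  rw [coeff_C_mul, coeff_natDegree, ← hl, one_mul] at this
  rwa [mul_comm]

end Prague
end SUB
open Polynomial

namespace SUB

lemma mult_card {κT B L Om : Type*} [Field κT] [Field B] [Field L] [Field Om] [IsAlgClosed Om]
    [Algebra κT L] [FiniteDimensional κT L] [Algebra B L] [Algebra.IsAlgebraic B L]
    (T : L) (ρ : Om) (I : Finset (B →+* Om))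
    (hI : ∀ τ ∈ I, (minpoly B T).eval₂ τ ρ = 0)
    (hcompat : ∀ ψ ψ' : L →+* Om, ψ.comp (algebraMap B L) ∈ I → ψ'.comp (algebraMap B L) ∈ I →
      ψ T = ρ → ψ' T = ρ → ψ.comp (algebraMap κT L) = ψ'.comp (algebraMap κT L)) :
    I.card ≤ Module.finrank κT L := by
  classical
  have hex : ∀ τ ∈ I, ∃ ψ : L →+* Om, ψ.comp (algebraMap B L) = τ ∧ ψ T = ρ := by
    intro τ hτ
    let _ : Algebra B Om := τ.toAlgebra
    obtain ⟨φ, hφ⟩ := IntermediateField.exists_algHom_of_splits_of_aeval (F := B) (E := L) (K := Om)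
      (x := T) (y := ρ) (fun s => ⟨Algebra.IsIntegral.isIntegral s, IsAlgClosed.splits _⟩) (hI τ hτ)
    exact ⟨φ.toRingHom, by ext b; exact φ.commutes b, hφ⟩
  rcases I.eq_empty_or_nonempty with rfl | ⟨τ0, hτ0⟩
  · simp
  obtain ⟨ψ0, h01, h02⟩ := hex τ0 hτ0
  let _ : Algebra κT Om := (ψ0.comp (algebraMap κT L)).toAlgebra
  have : Nonempty (L →+* Om) := ⟨ψ0⟩
  choose! ψ hψ1 hψ2 using hex
  have hcomm : ∀ τ ∈ I, (ψ τ).comp (algebraMap κT L) = algebraMap κT Om := fun τ hτ =>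
    hcompat _ _ (by rw [hψ1 τ hτ]; exact hτ) (by rw [h01]; exact hτ0) (hψ2 τ hτ) h02
  let f : I → (L →ₐ[κT] Om) := fun τ =>
    { ψ τ.1 with commutes' := fun r => RingHom.congr_fun (hcomm τ.1 τ.2) r }
  have hf : Function.Injective f := by
    intro τ τ' h
    have : ψ τ.1 = ψ τ'.1 := by
      ext x; exact DFunLike.congr_fun h x
    apply Subtype.ext
    rw [← hψ1 τ.1 τ.2, ← hψ1 τ'.1 τ'.2, this]
  have h1 := Nat.card_le_card_of_injective f hf
  have h2 := card_algHom_le_finrank κT L Om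
  rw [Nat.card_eq_fintype_card, Fintype.card_coe] at h1
  exact h1.trans h2

lemma prod_dvd_pow {Om ι : Type*} [Field Om] [IsAlgClosed Om] [Fintype ι] (m : ι → Om[X])
    (hm : ∀ i, (m i).Monic) (P : Om[X]) (hP : P ≠ 0) (hdvd : ∀ i, m i ∣ P) (N : ℕ)
    (hN : ∀ ρ : Om, ∀ I : Finset ι, (∀ i ∈ I, (m i).eval ρ = 0) → I.card ≤ N) :
    ∏ i, m i ∣ P ^ N := by
  classical
  have hne : ∏ i, m i ≠ 0 := Finset.prod_ne_zero_iff.2 (fun i _ => (hm i).ne_zero)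
  rw [(IsAlgClosed.splits _).dvd_iff_roots_le_roots hne (pow_ne_zero _ hP), Multiset.le_iff_count]
  intro ρ
  rw [roots_pow, Multiset.count_nsmul, roots_prod _ _ hne]
  rw [Multiset.count_bind]
  change ∑ i, Multiset.count ρ (m i).roots ≤ _
  set I : Finset ι := Finset.univ.filter (fun i => (m i).eval ρ = 0) with hI
  have h1 : ∑ i, Multiset.count ρ (m i).roots = ∑ i ∈ I, Multiset.count ρ (m i).roots := by
    symm
    apply Finset.sum_subset (Finset.subset_univ _)
    intro i _ hi
    rw [Multiset.count_eq_zero, mem_roots (hm i).ne_zero]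
    intro h
    exact hi (by simpa [hI] using h)
  have h2 : ∑ i ∈ I, Multiset.count ρ (m i).roots ≤ I.card • Multiset.count ρ P.roots :=
    Finset.sum_le_card_nsmul _ _ _
      (fun i _ => Multiset.count_le_of_le _ (roots.le_of_dvd hP (hdvd i)))
  have h3 : I.card ≤ N := hN ρ I (by intro i hi; simpa [hI] using hi)
  rw [h1]
  refine h2.trans ?_
  rw [smul_eq_mul]
  exact Nat.mul_le_mul_right _ h3

lemma norm_prod {κ B S : Type*} [Field κ] [Field B] [Field S] [Algebra κ B] [Algebra κ S]
    [FiniteDimensional κ B] [Algebra.IsSeparable κ B]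
    (hs : ∀ x : B, ((minpoly κ x).map (algebraMap κ S)).Splits) (x : B) :
    algebraMap κ S (Algebra.norm κ x) = ∏ τ : B →ₐ[κ] S, τ x := by
  let Om := AlgebraicClosure S
  apply FaithfulSMul.algebraMap_injective S Om
  rw [← IsScalarTower.algebraMap_apply, Algebra.norm_eq_prod_embeddings κ Om x, map_prod]
  symm
  let e : (B →ₐ[κ] S) → (B →ₐ[κ] Om) := fun τ => (IsScalarTower.toAlgHom κ S Om).comp τ
  have he : Function.Bijective e := by
    rw [Fintype.bijective_iff_injective_and_card]
    constructor
    · intro τ τ' h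
      ext b
      apply FaithfulSMul.algebraMap_injective S Om
      exact DFunLike.congr_fun h b
    · rw [AlgHom.card_of_splits κ B S hs, AlgHom.card]
  exact Fintype.prod_bijective e he _ _ (fun τ => rfl)

end SUB
open Polynomial

namespace SUB

section Core

lemma v_prod_le {S ι : Type*} [Field S] (v : AddValuation S (WithTop ℤ)) (s : Finset ι)
    (f : ι → S) (n : ι → ℤ) (h : ∀ i ∈ s, ((n i : ℤ) : WithTop ℤ) ≤ v (f i)) :
    ((∑ i ∈ s, n i : ℤ) : WithTop ℤ) ≤ v (∏ i ∈ s, f i) := by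
  classical
  induction s using Finset.induction_on with
  | empty => simp
  | insert i s hi ih =>
    rw [Finset.sum_insert hi, Finset.prod_insert hi, v.map_mul, WithTop.coe_add]
    exact add_le_add (h i (Finset.mem_insert_self _ _))
      (ih (fun j hj => h j (Finset.mem_insert_of_mem hj)))

lemma v_prod_eq {S ι : Type*} [Field S] (v : AddValuation S (WithTop ℤ)) (s : Finset ι)
    (f : ι → S) (n : ι → ℤ) (h : ∀ i ∈ s, v (f i) = ((n i : ℤ) : WithTop ℤ)) :
    v (∏ i ∈ s, f i) = ((∑ i ∈ s, n i : ℤ) : WithTop ℤ) := by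
  classical
  induction s using Finset.induction_on with
  | empty => simp
  | insert i s hi ih =>
    rw [Finset.sum_insert hi, Finset.prod_insert hi, v.map_mul, WithTop.coe_add,
      h i (Finset.mem_insert_self _ _), ih (fun j hj => h j (Finset.mem_insert_of_mem hj))]

lemma v_int {S : Type*} [Field S] (v : AddValuation S (WithTop ℤ)) (y : S) (hy : y ≠ 0) :
    ∃ n : ℤ, v y = (n : WithTop ℤ) := by
  have : v y ≠ ⊤ := fun h => hy (v.top_iff.1 h)
  obtain ⟨n, hn⟩ := WithTop.ne_top_iff_exists.1 this
  exact ⟨n, hn.symm⟩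

/-- The valuation ring of `v`. -/
def Ov {S : Type*} [Field S] (v : AddValuation S (WithTop ℤ)) : Subring S where
  carrier := {y | 0 ≤ v y}
  mul_mem' := fun {a b} ha hb => by
    change 0 ≤ v (a * b)
    rw [v.map_mul]; exact add_nonneg ha hb
  one_mem' := by change 0 ≤ v 1; rw [v.map_one]
  add_mem' := fun {a b} ha hb => (le_min ha hb).trans (v.map_add a b)
  zero_mem' := by change 0 ≤ v 0; rw [v.map_zero]; exact le_top
  neg_mem' := fun {a} ha => by change 0 ≤ v (-a); rw [v.map_neg]; exact ha

lemma v_integral {S : Type*} [Field S] (v : AddValuation S (WithTop ℤ)) (y : S)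
    (hy : IsIntegral (Ov v) y) : 0 ≤ v y := by
  have hI : Valuation.Integers (AddValuation.toValuation v) (Ov v) :=
    { hom_inj := Subtype.val_injective
      map_le_one := fun r => r.2
      exists_of_le_one := fun {r} h => ⟨⟨r, h⟩, rfl⟩ }
  exact hI.mem_of_integral hy

lemma IC_integralClosure {R Om : Type*} [CommRing R] [Field Om] [Algebra R Om] :
    IC (integralClosure R Om).toSubring := fun x hx =>
  isIntegral_trans (R := R) (A := integralClosure R Om) x hx

lemma coeff_natDegree_pow {k : Type*} [Field k] (P : k[X][X]) (N : ℕ)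
    (hP : ∀ n, (P.coeff n).natDegree ≤ N) (e : ℕ) :
    ∀ n, ((P ^ e).coeff n).natDegree ≤ e * N := by
  induction e with
  | zero => intro n; rw [pow_zero, coeff_one]; split_ifs <;> simp
  | succ e ih =>
    intro n
    rw [pow_succ, coeff_mul]
    apply natDegree_sum_le_of_forall_le
    intro i _
    refine natDegree_mul_le.trans ?_
    have h1 := ih i.1
    have h2 := hP i.2
    rw [add_mul, one_mul]; omega

variable {k κ B S : Type*} [Field k] [Field κ] [Field B] [Field S]
  [Algebra k[X] κ] [IsFractionRing k[X] κ] [Algebra κ B] [FiniteDimensional κ B]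
  [Algebra.IsSeparable κ B] [Algebra κ S] [Algebra k[X] S] [IsScalarTower k[X] κ S]

lemma norm_le (v : AddValuation S (WithTop ℤ))
    (hs : ∀ x : B, ((minpoly κ x).map (algebraMap κ S)).Splits)
    (hv : ∀ p : k[X], p ≠ 0 → v (algebraMap k[X] S p) = ((-(p.natDegree : ℤ) : ℤ) : WithTop ℤ))
    (z : B) (hz : z ≠ 0) (c : k[X]) (hc : c ≠ 0)
    (hint : IsIntegral k[X] (algebraMap k[X] S c * ∏ τ : B →ₐ[κ] S, τ z)) :
    v (algebraMap k[X] S c * ∏ τ : B →ₐ[κ] S, τ z) ≤ 0 := by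
  have e : algebraMap k[X] S c * ∏ τ : B →ₐ[κ] S, τ z
      = algebraMap κ S (algebraMap k[X] κ c * Algebra.norm κ z) := by
    rw [map_mul, norm_prod hs, ← IsScalarTower.algebraMap_apply]
  rw [e] at hint ⊢
  have h1 : IsIntegral k[X] (algebraMap k[X] κ c * Algebra.norm κ z) :=
    (isIntegral_algebraMap_iff (FaithfulSMul.algebraMap_injective κ S)).1 hint
  obtain ⟨p, hp⟩ := IsIntegrallyClosed.isIntegral_iff.1 h1
  have hp0 : p ≠ 0 := by
    rintro rfl
    rw [map_zero] at hp
    have h2 : algebraMap k[X] κ c ≠ 0 := by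
      rwa [Ne, FaithfulSMul.algebraMap_eq_zero_iff]
    have h3 : Algebra.norm κ z ≠ 0 := Algebra.norm_ne_zero_iff.2 hz
    exact mul_ne_zero h2 h3 hp.symm
  rw [← hp, ← IsScalarTower.algebraMap_apply, hv p hp0]
  exact_mod_cast (by omega : -(p.natDegree : ℤ) ≤ 0)

set_option maxHeartbeats 1000000 in
lemma core {L κT Om : Type*} [Field L] [Field κT] [Field Om] [IsAlgClosed Om]
    [Algebra S Om] [Algebra k[X] Om] [IsScalarTower k[X] S Om] [Algebra κT L] [FiniteDimensional κT L]
    [Algebra B L] [Algebra.IsAlgebraic B L]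
    (v : AddValuation S (WithTop ℤ)) (N q : ℕ) (hN : Module.finrank κT L ≤ N)
    (hs : ∀ x : B, ((minpoly κ x).map (algebraMap κ S)).Splits)
    (hv : ∀ p : k[X], p ≠ 0 → v (algebraMap k[X] S p) = ((-(p.natDegree : ℤ) : ℤ) : WithTop ℤ))
    (Φ : S →+* S) (hΦv : ∀ y (n : ℤ), v y = (n : WithTop ℤ) → v (Φ y) = ((q * n : ℤ) : WithTop ℤ))
    (hΦ1 : ∀ y, 0 ≤ v y → ((1 : ℤ) : WithTop ℤ) ≤ v (Φ y - y)) (hq : 0 < q)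
    (hΦp : ∀ p : k[X], Φ (algebraMap k[X] S p) = algebraMap k[X] S (expand k q p))
    (hΦfix : ∀ y, Φ y = y → ∃ c : k, y = algebraMap k[X] S (C c))
    (hB : ∀ b : B, ∃ b' : B, ∀ τ : B →ₐ[κ] S, τ b' = Φ (τ b))
    (jL : k[X] →+* L)
    (hjL : jL = (algebraMap B L).comp ((algebraMap κ B).comp (algebraMap k[X] κ)))
    (T : L) (hcompat : ∀ ψ ψ' : L →+* Om,
      (∀ c : k, ψ (jL (C c)) = ψ' (jL (C c))) → ψ T = ψ' T →
      ψ.comp (algebraMap κT L) = ψ'.comp (algebraMap κT L))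
    (hT : ∀ p : k[X], p ≠ 0 → p.eval₂ (jL.comp C) T ≠ 0)
    (P : k[X][X]) (hP0 : P ≠ 0) (hPN : ∀ n, (P.coeff n).natDegree ≤ N)
    (hPT : P.eval₂ jL T = 0) :
    Fintype.card (B →ₐ[κ] S) ≤ (q + 1) * (N * N) := by
  classical
  let jS : k[X] →+* S := algebraMap k[X] S
  let jB : k[X] →+* B := (algebraMap κ B).comp (algebraMap k[X] κ)
  let jO : k[X] →+* Om := (algebraMap S Om).comp jS
  have hτj : ∀ (τ : B →ₐ[κ] S) p, τ (jB p) = jS p := by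
    intro τ p
    change τ (algebraMap κ B _) = _
    rw [τ.commutes, ← IsScalarTower.algebraMap_apply]
  have hjSinj : Function.Injective jS := by
    rw [injective_iff_map_eq_zero]
    intro p hp
    by_contra h
    have h2 := hv p h
    change v (jS p) = _ at h2
    rw [hp, v.map_zero] at h2
    exact WithTop.coe_ne_top h2.symm
  have hjOinj : Function.Injective jO :=
    (FaithfulSMul.algebraMap_injective S Om).comp hjSinj
  set m := minpoly B T with hm
  have hTint : IsIntegral B T := Algebra.IsIntegral.isIntegral T
  have hmm : m.Monic := minpoly.monic hTint
  let e : (B →ₐ[κ] S) → (B →+* Om) := fun τ => (algebraMap S Om).comp τ.toRingHom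
  have he : Function.Injective e := by
    intro τ τ' h
    ext b
    exact FaithfulSMul.algebraMap_injective S Om (RingHom.congr_fun h b)
  have hej : ∀ τ, (e τ).comp jB = jO := by
    intro τ
    ext p
    · change algebraMap S Om (τ (jB _)) = algebraMap S Om _
      rw [hτj]
    · change algebraMap S Om (τ (jB _)) = algebraMap S Om _
      rw [hτj]
  have hdvd1 : m ∣ P.map jB := by
    apply minpoly.dvd
    rw [aeval_def, eval₂_map, ← hjL, hPT]
  have hPO : P.map jO ≠ 0 := (Polynomial.map_ne_zero_iff hjOinj).2 hP0
  have hdvd2 : ∏ τ, m.map (e τ) ∣ (P.map jO) ^ N := by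
    apply prod_dvd_pow
    · intro τ; exact hmm.map _
    · exact hPO
    · intro τ
      have h0 := (Polynomial.map_dvd_map' (e τ)).2 hdvd1
      rw [Polynomial.map_map jB, hej τ] at h0
      exact h0
    · intro ρ I hI
      refine le_trans ?_ hN
      rw [← Finset.card_image_of_injective I he]
      apply mult_card T ρ
      · intro τ' hτ'
        obtain ⟨τ, hτ, rfl⟩ := Finset.mem_image.1 hτ'
        rw [← eval_map]; exact hI τ hτ
      · intro ψ ψ' h1 h2 h3 h4
        apply hcompat
        · intro c
          obtain ⟨τ1, -, e1⟩ := Finset.mem_image.1 h1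
          obtain ⟨τ2, -, e2⟩ := Finset.mem_image.1 h2
          have f1 : ψ (jL (C c)) = jO (C c) := by
            rw [hjL]; change (ψ.comp (algebraMap B L)) (jB (C c)) = _
            rw [← e1, ← hej τ1]; rfl
          have f2 : ψ' (jL (C c)) = jO (C c) := by
            rw [hjL]; change (ψ'.comp (algebraMap B L)) (jB (C c)) = _
            rw [← e2, ← hej τ2]; rfl
          rw [f1, f2]
        · rw [h3, h4]
  set a : k[X] := (P ^ N).leadingCoeff with ha
  have ha0 : a ≠ 0 := leadingCoeff_ne_zero.2 (pow_ne_zero _ hP0)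
  -- the general consequence of the Prague theorem
  have hgen : ∀ (O : Subring Om), IC O → ∀ u : S, u ≠ 0 →
      Cf O (C (algebraMap S Om u) * (P.map jO) ^ N) → ∀ (i : ℕ) (U : Finset (B →ₐ[κ] S)),
      algebraMap S Om (u * jS a * ∏ τ ∈ U, τ (m.coeff i)) ∈ O := by
    intro O hO u hu hC i U
    have hu' : algebraMap S Om u ≠ 0 := by
      rwa [Ne, FaithfulSMul.algebraMap_eq_zero_iff]
    have h := prague hO Finset.univ (fun τ => m.map (e τ)) (fun τ => hmm.map _)
      (fun τ => if τ ∈ U then i else m.natDegree) _ hC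
      (mul_ne_zero (C_ne_zero.2 hu') (pow_ne_zero _ hPO)) (hdvd2.mul_left _)
    rw [leadingCoeff_mul, leadingCoeff_C, ← Polynomial.map_pow,
      leadingCoeff_map_of_injective hjOinj] at h
    have h2 : ∏ τ, (m.map (e τ)).coeff (if τ ∈ U then i else m.natDegree)
        = algebraMap S Om (∏ τ ∈ U, τ (m.coeff i)) := by
      rw [map_prod, ← Finset.prod_subset (Finset.subset_univ U)]
      · apply Finset.prod_congr rfl
        intro τ hτ
        rw [if_pos hτ, coeff_map]; rfl
      · intro τ _ hτ
        rw [if_neg hτ, coeff_map, coeff_natDegree, hmm.leadingCoeff, map_one]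
    rw [h2] at h
    rw [map_mul, map_mul]
    exact h
  have hint : ∀ i (U : Finset (B →ₐ[κ] S)), IsIntegral k[X] (jS a * ∏ τ ∈ U, τ (m.coeff i)) := by
    intro i U
    have h := hgen (integralClosure k[X] Om).toSubring IC_integralClosure 1 one_ne_zero (by
      intro n
      rw [map_one, C_1, one_mul, ← Polynomial.map_pow, coeff_map]
      change IsIntegral k[X] (algebraMap S Om (algebraMap k[X] S _))
      rw [← IsScalarTower.algebraMap_apply]
      exact (isIntegral_algebraMap (R := k[X]) (A := Om))) i U
    rw [one_mul] at h
    exact (isIntegral_algebraMap_iff (FaithfulSMul.algebraMap_injective S Om)).1 h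
  have hX0 : jS X ≠ 0 := by
    intro h
    exact X_ne_zero (hjSinj (h.trans (map_zero _).symm))
  have hval : ∀ i (U : Finset (B →ₐ[κ] S)),
      0 ≤ v ((jS X)⁻¹ ^ (N * N) * jS a * ∏ τ ∈ U, τ (m.coeff i)) := by
    intro i U
    have hu : ∀ p : k[X], p.natDegree ≤ N * N → (jS X)⁻¹ ^ (N * N) * jS p ∈ Ov v := by
      intro p hp
      by_cases h0 : p = 0
      · rw [h0, map_zero, mul_zero]; exact (Ov v).zero_mem
      have e1 : (jS X) ^ (N * N) * ((jS X)⁻¹ ^ (N * N) * jS p) = jS p := by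
        rw [← mul_assoc, ← mul_pow, mul_inv_cancel₀ hX0, one_pow, one_mul]
      have hne : (jS X)⁻¹ ^ (N * N) * jS p ≠ 0 :=
        mul_ne_zero (pow_ne_zero _ (inv_ne_zero hX0))
          (fun h => h0 (hjSinj (h.trans (map_zero _).symm)))
      obtain ⟨n, hn⟩ := v_int v _ hne
      have e2 := congrArg v e1
      rw [v.map_mul, hn, ← map_pow] at e2
      change v (algebraMap k[X] S _) + _ = v (algebraMap k[X] S _) at e2
      rw [hv _ h0, hv _ (pow_ne_zero _ X_ne_zero), natDegree_X_pow, ← WithTop.coe_add,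
        WithTop.coe_inj] at e2
      change 0 ≤ v _
      rw [hn]
      have : (p.natDegree : ℤ) ≤ (N * N : ℕ) := by exact_mod_cast hp
      exact_mod_cast (by omega : 0 ≤ n)
    have h := hgen (integralClosure (Ov v) Om).toSubring IC_integralClosure ((jS X)⁻¹ ^ (N * N))
      (pow_ne_zero _ (inv_ne_zero hX0)) (by
      intro n
      rw [← Polynomial.map_pow, coeff_C_mul, coeff_map]
      change IsIntegral (Ov v) _
      have := hu _ (coeff_natDegree_pow P N hPN N n)
      have h2 := isIntegral_algebraMap (R := Ov v) (A := Om) (x := ⟨_, this⟩)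
      have h3 : algebraMap (Ov v) Om ⟨_, this⟩
        = algebraMap S Om ((jS X)⁻¹ ^ (N * N) * jS ((P ^ N).coeff n)) := rfl
      rw [h3, map_mul] at h2
      exact h2) i U
    apply v_integral
    exact (isIntegral_algebraMap_iff (FaithfulSMul.algebraMap_injective S Om)).1 h
  by_cases hemp : IsEmpty (B →ₐ[κ] S)
  · rw [Fintype.card_eq_zero]; exact Nat.zero_le _
  rw [not_isEmpty_iff] at hemp
  obtain ⟨τ0⟩ := hemp
  choose φ hφ using hB
  -- a coefficient which is not constant
  obtain ⟨i, hi⟩ : ∃ i, φ (m.coeff i) - m.coeff i ≠ 0 := by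
    by_contra hcon
    push Not at hcon
    have hc : ∀ i, ∃ c : k, m.coeff i = jB (C c) := by
      intro i
      have h1 : Φ (τ0 (m.coeff i)) = τ0 (m.coeff i) := by
        rw [← hφ, sub_eq_zero.1 (hcon i)]
      obtain ⟨c, hc⟩ := hΦfix _ h1
      refine ⟨c, τ0.toRingHom.injective ?_⟩
      change τ0 _ = τ0 _
      rw [hc, hτj]
    have hl : m ∈ lifts (jB.comp C) := by
      rw [lifts_iff_coeff_lifts]
      intro n
      obtain ⟨c, hc⟩ := hc n
      exact ⟨c, hc.symm⟩
    obtain ⟨p, hp⟩ := (mem_lifts _).1 hl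
    have hp0 : p ≠ 0 := by
      rintro rfl
      rw [Polynomial.map_zero] at hp
      exact hmm.ne_zero hp.symm
    apply hT p hp0
    have h3 := minpoly.aeval B T
    rw [← hm, ← hp, aeval_def, eval₂_map] at h3
    rw [hjL]
    exact h3
  set b := m.coeff i with hb
  have hτz : ∀ τ : B →ₐ[κ] S, τ (φ b - b) = Φ (τ b) - τ b := by
    intro τ; rw [map_sub, hφ]
  have hτb0 : ∀ τ : B →ₐ[κ] S, τ b ≠ 0 := by
    intro τ h
    have h2 := hτz τ
    rw [h, map_zero, sub_zero] at h2
    exact hi ((map_eq_zero_iff _ τ.toRingHom.injective).1 h2)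
  choose n hn using fun τ : B →ₐ[κ] S => v_int v (τ b) (hτb0 τ)
  have hΦint : ∀ y, IsIntegral k[X] y → IsIntegral k[X] (Φ y) := by
    intro y hy
    apply IsIntegral.map_of_comp_eq (expand k q).toRingHom Φ _ hy
    ext p
    · exact (hΦp _).symm
    · exact (hΦp _).symm
  have hw : IsIntegral k[X] (algebraMap k[X] S (a * expand k q a)
      * ∏ τ : B →ₐ[κ] S, τ (φ b - b)) := by
    simp_rw [hτz, sub_eq_add_neg]
    rw [Finset.prod_add, Finset.mul_sum]
    apply IsIntegral.sum
    intro U _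
    have e1 : algebraMap k[X] S (a * expand k q a) * ((∏ τ ∈ U, Φ (τ b))
        * ∏ τ ∈ Finset.univ \ U, -τ b)
        = Φ (jS a * ∏ τ ∈ U, τ b) * (jS a * ∏ τ ∈ Finset.univ \ U, τ b)
          * (-1) ^ (Finset.univ \ U).card := by
      rw [map_mul, map_mul, map_prod, Finset.prod_neg, hΦp]
      change jS a * _ * _ = _
      ring
    rw [e1]
    exact ((hΦint _ (hint i U)).mul (hint i _)).mul ((isIntegral_one.neg).pow _)
  have hc0 : a * expand k q a ≠ 0 := mul_ne_zero ha0 ((expand_ne_zero hq).2 ha0)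
  have h1 := norm_le v hs hv (φ b - b) hi _ hc0 hw
  -- lower bound
  set U0 : Finset (B →ₐ[κ] S) := Finset.univ.filter (fun τ => n τ < 0) with hU0
  have h2 := hval i U0
  have hvu : v ((jS X)⁻¹ ^ (N * N)) = ((N * N : ℕ) : ℤ) := by
    obtain ⟨l, hl⟩ := v_int v _ (pow_ne_zero (N * N) (inv_ne_zero hX0))
    have e1 : (jS X) ^ (N * N) * (jS X)⁻¹ ^ (N * N) = 1 := by
      rw [← mul_pow, mul_inv_cancel₀ hX0, one_pow]
    have e2 := congrArg v e1
    rw [v.map_mul, hl, ← map_pow, v.map_one] at e2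
    change v (algebraMap k[X] S _) + _ = _ at e2
    rw [hv _ (pow_ne_zero _ X_ne_zero), natDegree_X_pow, ← WithTop.coe_add,
      ← WithTop.coe_zero, WithTop.coe_inj] at e2
    rw [hl, WithTop.coe_inj]; omega
  rw [v.map_mul, v.map_mul, hvu, v_prod_eq v U0 _ n (fun τ _ => hn τ)] at h2
  change 0 ≤ _ + v (algebraMap k[X] S a) + _ at h2
  rw [hv a ha0, ← WithTop.coe_add, ← WithTop.coe_add, ← WithTop.coe_zero, WithTop.coe_le_coe] at h2
  have h3 : ∀ τ ∈ (Finset.univ : Finset (B →ₐ[κ] S)),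
      (((if n τ < 0 then (q + 1) * n τ else 0) + 1 : ℤ) : WithTop ℤ) ≤ v (τ (φ b - b)) := by
    intro τ _
    rw [hτz]
    split_ifs with h
    · refine le_trans ?_ (v.map_sub _ _)
      rw [hn, hΦv _ _ (hn τ), le_min_iff, WithTop.coe_le_coe, WithTop.coe_le_coe]
      have : (1 : ℤ) ≤ q := by exact_mod_cast hq
      constructor <;> nlinarith
    · rw [zero_add]
      apply hΦ1
      rw [hn]
      exact_mod_cast not_lt.1 h
  have h4 := v_prod_le v Finset.univ _ _ h3
  have h5 := hv _ hc0
  rw [v.map_mul, h5] at h1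
  have h6 := (add_le_add_right h4 _).trans h1
  rw [← WithTop.coe_add, ← WithTop.coe_zero, WithTop.coe_le_coe, Finset.sum_add_distrib,
    natDegree_mul ha0 ((expand_ne_zero hq).2 ha0), natDegree_expand] at h6
  have h7 : ∑ τ : B →ₐ[κ] S, (if n τ < 0 then ((q : ℤ) + 1) * n τ else 0)
      = (q + 1) * ∑ τ ∈ U0, n τ := by
    rw [Finset.mul_sum, hU0, Finset.sum_filter]
  rw [h7] at h6
  simp only [Finset.sum_const, Finset.card_univ, nsmul_eq_mul, mul_one] at h6
  push_cast at h6 h2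
  have : (Fintype.card (B →ₐ[κ] S) : ℤ) ≤ (q + 1) * (N * N) := by
    have hq' : (0 : ℤ) ≤ q := by exact_mod_cast hq.le
    nlinarith
  exact_mod_cast this

end Core
end SUB
open Polynomial

namespace SUB

/-- Laurent series in `1/t`, as a type synonym free of unwanted algebra instances. -/
def Lau (k : Type*) [Field k] : Type _ := HahnSeries ℤ k

noncomputable section LauSec

variable {k : Type*} [Field k]

instance : Field (Lau k) := inferInstanceAs (Field (HahnSeries ℤ k))

namespace Lau

/-- The valuation at infinity. -/
def v : AddValuation (Lau k) (WithTop ℤ) := HahnSeries.addVal ℤ k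

/-- Coefficients. -/
def cf (x : Lau k) (n : ℤ) : k := HahnSeries.coeff x n

/-- Monomials. -/
def mono (n : ℤ) (c : k) : Lau k := HahnSeries.single n c

lemma ext' {x y : Lau k} (h : ∀ n, cf x n = cf y n) : x = y := HahnSeries.ext (funext h)

lemma le_v {x : Lau k} {n : ℤ} : (n : WithTop ℤ) ≤ v x ↔ ∀ m : ℤ, m < n → cf x m = 0 := by
  have h : ∀ y : HahnSeries ℤ k, (n : WithTop ℤ) ≤ HahnSeries.addVal ℤ k y ↔
      ∀ m : ℤ, m < n → y.coeff m = 0 := by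
    intro y
    rw [HahnSeries.addVal_apply, HahnSeries.le_orderTop_iff_forall]
    simp only [WithTop.coe_lt_coe]
  exact h x

lemma cf_add (x y : Lau k) (n : ℤ) : cf (x + y) n = cf x n + cf y n := rfl
lemma cf_sub (x y : Lau k) (n : ℤ) : cf (x - y) n = cf x n - cf y n := rfl
lemma cf_zero (n : ℤ) : cf (0 : Lau k) n = 0 := rfl

lemma cf_mono (n m : ℤ) (c : k) : cf (mono n c) m = if m = n then c else 0 := by
  by_cases h : m = n
  · subst h; simp [cf, mono]
  · rw [if_neg h]; exact HahnSeries.coeff_single_of_ne h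

lemma mono_mul (n m : ℤ) (a b : k) : mono n a * mono m b = mono (n + m) (a * b) :=
  HahnSeries.single_mul_single

lemma mono_zero_one : mono 0 (1 : k) = 1 := rfl

lemma mono_pow (n : ℤ) (a : k) (e : ℕ) : (mono n a) ^ e = mono (e * n) (a ^ e) := by
  induction e with
  | zero => simp [mono_zero_one]
  | succ e ih => rw [pow_succ, ih, mono_mul, pow_succ]; congr 1; push_cast; ring

lemma exists_le_v (x : Lau k) : ∃ n : ℤ, (n : WithTop ℤ) ≤ v x := by
  rcases h : v x with _ | n
  · exact ⟨0, le_top⟩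
  · exact ⟨n, le_rfl⟩

lemma eq_zero_of_le {x : Lau k} (h : ∀ n : ℕ, ((n : ℤ) : WithTop ℤ) ≤ v x) : x = 0 := by
  apply ext'
  intro n
  exact le_v.1 (h (n.toNat + 1)) n (by omega)

/-- The constants. -/
def Cc : k →+* Lau k := HahnSeries.C

lemma Cc_apply (c : k) : Cc c = mono 0 c := rfl

instance : Algebra k[X] (Lau k) := (eval₂RingHom Cc (mono (-1) 1)).toAlgebra

lemma alg_eq (p : k[X]) : algebraMap k[X] (Lau k) p = p.eval₂ Cc (mono (-1) 1) := rfl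

lemma cf_alg (p : k[X]) (n : ℤ) :
    cf (algebraMap k[X] (Lau k) p) n = if n ≤ 0 then p.coeff (-n).toNat else 0 := by
  rw [alg_eq]
  induction p using Polynomial.induction_on' with
  | add p q hp hq =>
    rw [eval₂_add, cf_add, hp, hq]; split_ifs <;> simp
  | monomial m a =>
    rw [eval₂_monomial, mono_pow, Cc_apply, mono_mul, one_pow, mul_one, cf_mono, coeff_monomial]
    split_ifs <;> first | rfl | omega

lemma v_eq_iff {x : Lau k} {n : ℤ} : v x = n ↔ cf x n ≠ 0 ∧ ∀ m : ℤ, m < n → cf x m = 0 := by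
  constructor
  · intro h
    refine ⟨fun h0 => ?_, le_v.1 h.ge⟩
    have : ((n + 1 : ℤ) : WithTop ℤ) ≤ v x := le_v.2 (fun m hm => by
      rcases (Int.lt_add_one_iff.1 hm).lt_or_eq with h1 | rfl
      · exact le_v.1 h.ge m h1
      · exact h0)
    rw [h, WithTop.coe_le_coe] at this
    omega
  · rintro ⟨h0, h⟩
    apply le_antisymm _ (le_v.2 h)
    by_contra hlt
    rw [not_le] at hlt
    obtain ⟨m, hm⟩ := exists_le_v x
    have : ((n + 1 : ℤ) : WithTop ℤ) ≤ v x := by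
      rcases hx : v x with _ | l
      · exact le_top
      · rw [hx] at hlt
        change ((n + 1 : ℤ) : WithTop ℤ) ≤ (l : WithTop ℤ)
        change (n : WithTop ℤ) < (l : WithTop ℤ) at hlt
        rw [WithTop.coe_lt_coe] at hlt
        rw [WithTop.coe_le_coe]; omega
    exact h0 (le_v.1 this n (by omega))

lemma v_alg (p : k[X]) (hp : p ≠ 0) :
    v (algebraMap k[X] (Lau k) p) = ((-(p.natDegree : ℤ) : ℤ) : WithTop ℤ) := by
  rw [v_eq_iff]
  constructor
  · rw [cf_alg, if_pos (by omega), neg_neg, Int.toNat_natCast, coeff_natDegree]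
    exact leadingCoeff_ne_zero.2 hp
  · intro m hm
    rw [cf_alg, if_pos (by omega)]
    exact coeff_eq_zero_of_natDegree_lt (by omega)

/-- Substitution `X ↦ X ^ q`. -/
def Phi (q : ℕ) (hq : 0 < q) : Lau k →+* Lau k :=
  HahnSeries.embDomainRingHom (AddMonoidHom.mulLeft (q : ℤ))
    (fun a b h => by
      have : (q : ℤ) ≠ 0 := by exact_mod_cast hq.ne'
      exact mul_left_cancel₀ this h)
    (fun a b => mul_le_mul_iff_right₀ (by exact_mod_cast hq))

variable (q : ℕ) (hq : 0 < q)

lemma cf_Phi_mul (x : Lau k) (n : ℤ) : cf (Phi q hq x) (q * n) = cf x n :=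
  HahnSeries.embDomain_coeff (f := ⟨⟨AddMonoidHom.mulLeft (q : ℤ), _⟩, _⟩)

lemma cf_Phi_not (x : Lau k) (n : ℤ) (h : ¬ (q : ℤ) ∣ n) : cf (Phi q hq x) n = 0 :=
  HahnSeries.embDomain_of_notMem_range (f := ⟨⟨AddMonoidHom.mulLeft (q : ℤ), _⟩, _⟩)
    (by rintro ⟨m, hm⟩; exact h ⟨m, hm.symm⟩)

lemma v_Phi (x : Lau k) (n : ℤ) (h : v x = n) : v (Phi q hq x) = ((q * n : ℤ) : WithTop ℤ) := by
  rw [v_eq_iff] at h ⊢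
  have hq' : (0 : ℤ) < q := by exact_mod_cast hq
  refine ⟨by rw [cf_Phi_mul]; exact h.1, fun m hm => ?_⟩
  by_cases hd : (q : ℤ) ∣ m
  · obtain ⟨l, rfl⟩ := hd
    rw [cf_Phi_mul]
    exact h.2 l (lt_of_mul_lt_mul_left hm hq'.le)
  · exact cf_Phi_not q hq x m hd

lemma v_Phi_le (x : Lau k) (n : ℤ) (h : n ≤ v x) : ((q * n : ℤ) : WithTop ℤ) ≤ v (Phi q hq x) := by
  by_cases hx : x = 0
  · rw [hx, map_zero, v.map_zero]; exact le_top
  · obtain ⟨m, hm⟩ := WithTop.ne_top_iff_exists.1 (fun h => hx (v.top_iff.1 h) : v x ≠ ⊤)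
    rw [v_Phi q hq x m hm.symm, WithTop.coe_le_coe]
    rw [← hm, WithTop.coe_le_coe] at h
    exact mul_le_mul_of_nonneg_left h (by positivity)

lemma Phi_sub (x : Lau k) (h : 0 ≤ v x) : ((1 : ℤ) : WithTop ℤ) ≤ v (Phi q hq x - x) := by
  have hx := (le_v (n := 0)).1 h
  have hx2 := le_v.1 (v_Phi_le q hq x 0 h)
  rw [le_v]
  intro m hm
  rw [cf_sub]
  rcases (by omega : m < 0 ∨ m = 0) with h1 | rfl
  · rw [hx m h1, hx2 m (by omega), sub_zero]
  · have := cf_Phi_mul q hq x 0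
    rw [mul_zero] at this
    rw [this, sub_self]

lemma Phi_mono (n : ℤ) (c : k) : Phi q hq (mono n c) = mono (q * n) c :=
  HahnSeries.embDomain_single

lemma Phi_alg (p : k[X]) :
    Phi q hq (algebraMap k[X] (Lau k) p) = algebraMap k[X] (Lau k) (expand k q p) := by
  rw [alg_eq, alg_eq]
  induction p using Polynomial.induction_on' with
  | add p q hp hq => rw [eval₂_add, map_add, hp, hq, map_add, eval₂_add]
  | monomial m a =>
    rw [eval₂_monomial, expand_monomial, eval₂_monomial, mono_pow, mono_pow, Cc_apply, mono_mul,
      mono_mul, Phi_mono]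
    congr 1
    · push_cast; ring
    · simp

lemma Phi_fix (hq2 : 1 < q) (y : Lau k) (h : Phi q hq y = y) :
    ∃ c : k, y = algebraMap k[X] (Lau k) (C c) := by
  refine ⟨cf y 0, ?_⟩
  rw [alg_eq, eval₂_C, Cc_apply]
  have key : ∀ (N : ℕ) (n : ℤ), n ≠ 0 → n.natAbs < N → cf y n = 0 := by
    intro N
    induction N with
    | zero => intro n _ h; omega
    | succ N ih =>
      intro n hn hN
      rw [← h]
      by_cases hd : (q : ℤ) ∣ n
      · obtain ⟨l, rfl⟩ := hd
        rw [cf_Phi_mul]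
        have hl : l ≠ 0 := by rintro rfl; simp at hn
        apply ih l hl
        rw [Int.natAbs_mul, Int.natAbs_natCast] at hN
        have : 0 < l.natAbs := Int.natAbs_pos.2 hl
        nlinarith
      · exact cf_Phi_not q hq y n hd
  apply ext'
  intro n
  rw [cf_mono]
  split_ifs with h0
  · rw [h0]
  · exact key _ n h0 (Nat.lt_succ_self _)

/-- Change of coefficient field. -/
def mp {F : Type*} [Field F] (f : F →+* k) : Lau F →+* Lau k where
  toFun x := HahnSeries.map (Γ := ℤ) (R := F) x (f : F →ₙ+* k)
  map_zero' := by apply ext'; intro n; exact map_zero f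
  map_one' := by
    apply ext'; intro n
    change f (cf 1 n) = _
    rw [← mono_zero_one, ← mono_zero_one, cf_mono, cf_mono]
    split_ifs <;> simp
  map_add' x y := by apply ext'; intro n; exact map_add f _ _
  map_mul' x y := HahnSeries.map_mul (Γ := ℤ) (R := F) (S := k) (f : F →ₙ+* k) (x := x) (y := y)

lemma cf_mp {F : Type*} [Field F] (f : F →+* k) (x : Lau F) (n : ℤ) : cf (mp f x) n = f (cf x n) :=
  rfl

lemma mp_mono {F : Type*} [Field F] (f : F →+* k) (c : F) (n : ℤ) :
    mp f (mono n c) = mono n (f c) := by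
  apply ext'; intro m
  rw [cf_mp, cf_mono, cf_mono]; split_ifs <;> simp

lemma mp_alg {F : Type*} [Field F] (f : F →+* k) (p : F[X]) :
    mp f (algebraMap F[X] (Lau F) p) = algebraMap k[X] (Lau k) (p.map f) := by
  apply ext'; intro n
  rw [cf_mp, cf_alg, cf_alg]
  split_ifs <;> simp

lemma mp_Phi {F : Type*} [Field F] (f : F →+* k) (x : Lau F) :
    Phi q hq (mp f x) = mp f (Phi q hq x) := by
  apply ext'; intro n
  by_cases hd : (q : ℤ) ∣ n
  · obtain ⟨l, rfl⟩ := hd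
    rw [cf_Phi_mul, cf_mp, cf_mp, cf_Phi_mul]
  · rw [cf_Phi_not _ _ _ _ hd, cf_mp, cf_Phi_not _ _ _ _ hd, map_zero]

lemma Phi_frob {F : Type*} [Field F] [Fintype F] (y : Lau F) :
    Phi (Fintype.card F) Fintype.card_pos y = y ^ Fintype.card F := by
  set q := Fintype.card F with hqdef
  obtain ⟨p, hp⟩ := CharP.exists F
  have hpp : p.Prime := CharP.char_is_prime F p
  have : Fact p.Prime := ⟨hpp⟩
  obtain ⟨e, -, he⟩ := FiniteField.card F p
  have : CharP (Lau F) p := charP_of_injective_ringHom (Cc (k := F)).injective p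
  have hadd : ∀ x y : Lau F, (x - y) ^ q = x ^ q - y ^ q := by
    intro x y; rw [hqdef, he]; exact sub_pow_char_pow x y _
  have hmono : ∀ n c, Phi q Fintype.card_pos (mono n c : Lau F) = (mono n c) ^ q := by
    intro n c
    rw [Phi_mono, mono_pow, FiniteField.pow_card]
  have key : ∀ (j : ℕ) (y : Lau F) (n : ℤ), n ≤ v y → ∃ r : Lau F, ((n + j : ℤ) : WithTop ℤ) ≤ v r ∧
      Phi q Fintype.card_pos y - y ^ q = Phi q Fintype.card_pos r - r ^ q := by
    intro j
    induction j with
    | zero => intro y n h; exact ⟨y, by simpa using h, rfl⟩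
    | succ j ih =>
      intro y n h
      obtain ⟨r, hr, e⟩ := ih y n h
      refine ⟨r - mono (n + j) (cf r (n + j)), ?_, ?_⟩
      · rw [le_v] at hr ⊢
        intro m hm
        rw [cf_sub, cf_mono]
        split_ifs with h1
        · rw [h1, sub_self]
        · rw [hr m (by push_cast at hm; omega), sub_zero]
      · rw [e, map_sub, hadd, hmono]; ring
  obtain ⟨n, hn⟩ := exists_le_v y
  apply sub_eq_zero.1
  apply eq_zero_of_le
  intro N
  obtain ⟨r, hr, e⟩ := key (n.natAbs + N) y n hn
  have hr' : ((N : ℤ) : WithTop ℤ) ≤ v r := le_trans (WithTop.coe_le_coe.2 (by omega)) hr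
  rw [e]
  have hq1 : (1 : ℤ) ≤ q := by exact_mod_cast Fintype.card_pos (α := F)
  refine le_trans (le_min ?_ ?_) (v.map_sub _ _)
  · refine le_trans (WithTop.coe_le_coe.2 ?_) (v_Phi_le q Fintype.card_pos r N hr')
    nlinarith
  · rw [v.map_pow]
    refine le_trans ?_ (nsmul_le_nsmul_right hr' q)
    rw [← WithTop.coe_nsmul, WithTop.coe_le_coe, nsmul_eq_mul]
    nlinarith

end Lau
end LauSec
end SUB
open Polynomial

namespace SUB

section Dyn

open Lau

lemma Lau.complete {F : Type*} [Field F] (x : ℕ → Lau F) (μ : ℤ)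
    (h : ∀ t : ℕ, ((t - μ : ℤ) : WithTop ℤ) ≤ v (x (t + 1) - x t)) :
    ∃ y : Lau F, ∀ t : ℕ, ((t - μ : ℤ) : WithTop ℤ) ≤ v (y - x t) := by
  have hst : ∀ (n : ℤ) (t j : ℕ), n < t - μ → cf (x (t + j)) n = cf (x t) n := by
    intro n t j hn
    induction j with
    | zero => rfl
    | succ j ih =>
      have := le_v.1 (h (t + j)) n (by push_cast; omega)
      rw [cf_sub, sub_eq_zero] at this
      rw [← ih, ← this]; rfl
  obtain ⟨M, hM⟩ := exists_le_v (x 0)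
  rw [le_v] at hM
  have hb : BddBelow (Function.support (fun n : ℤ => cf (x (n + μ + 1).toNat) n)) := by
    refine ⟨min M (-μ), ?_⟩
    intro n hn
    by_contra hlt
    rw [not_le, lt_min_iff] at hlt
    apply hn
    have : (n + μ + 1).toNat = 0 := by omega
    change cf (x (n + μ + 1).toNat) n = 0
    rw [this]
    exact hM n hlt.1
  let y : Lau F := HahnSeries.ofSuppBddBelow (fun n : ℤ => cf (x (n + μ + 1).toNat) n) hb
  refine ⟨y, fun t => le_v.2 ?_⟩
  intro n hn
  rw [cf_sub, sub_eq_zero]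
  change cf (x (n + μ + 1).toNat) n = _
  obtain ⟨j, hj⟩ : ∃ j, t = (n + μ + 1).toNat + j := ⟨t - (n + μ + 1).toNat, by omega⟩
  rw [hj, hst]
  omega

lemma v_prod_sub {S ι : Type*} [Field S] (v : AddValuation S (WithTop ℤ)) (s : Finset ι)
    (f g : ι → S) (e : ι → ℤ) (n r : ℤ) (hf : ∀ i ∈ s, ((-e i : ℤ) : WithTop ℤ) ≤ v (f i))
    (hg : ∀ i ∈ s, ((-e i : ℤ) : WithTop ℤ) ≤ v (g i))
    (hfg : ∀ i ∈ s, (n : WithTop ℤ) ≤ v (f i - g i)) (hr : ∀ i ∈ s, r ≤ e i) :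
    ((n + r - ∑ i ∈ s, e i : ℤ) : WithTop ℤ) ≤ v (∏ i ∈ s, f i - ∏ i ∈ s, g i) ∧
    ((- ∑ i ∈ s, e i : ℤ) : WithTop ℤ) ≤ v (∏ i ∈ s, g i) := by
  classical
  induction s using Finset.induction_on with
  | empty => simp
  | insert i s hi ih =>
    obtain ⟨h1, h2⟩ := ih (fun j hj => hf j (Finset.mem_insert_of_mem hj))
      (fun j hj => hg j (Finset.mem_insert_of_mem hj))
      (fun j hj => hfg j (Finset.mem_insert_of_mem hj))
      (fun j hj => hr j (Finset.mem_insert_of_mem hj))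
    have hii := Finset.mem_insert_self i s
    rw [Finset.prod_insert hi, Finset.prod_insert hi, Finset.sum_insert hi]
    constructor
    · have e1 : f i * ∏ j ∈ s, f j - g i * ∏ j ∈ s, g j
          = f i * (∏ j ∈ s, f j - ∏ j ∈ s, g j) + (f i - g i) * ∏ j ∈ s, g j := by ring
      rw [e1]
      refine le_trans (le_min ?_ ?_) (v.map_add _ _)
      · rw [v.map_mul]
        refine le_trans ?_ (add_le_add (hf i hii) h1)
        rw [← WithTop.coe_add, WithTop.coe_le_coe]; omega
      · rw [v.map_mul]
        refine le_trans ?_ (add_le_add (hfg i hii) h2)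
        have := hr i hii
        rw [← WithTop.coe_add, WithTop.coe_le_coe]; omega
    · rw [v.map_mul]
      refine le_trans ?_ (add_le_add (hg i hii) h2)
      rw [← WithTop.coe_add, WithTop.coe_le_coe]; omega

variable {F : Type*} [Field F] {d : ℕ} (α : Fin d → F[X])

/-- Image of `α i` in the Laurent series field. -/
noncomputable def al (i : Fin d) : Lau F := algebraMap F[X] (Lau F) (α i)

/-- Maximal degree. -/
def mu : ℕ := Finset.univ.sup fun ℓ => (α ℓ).natDegree

/-- Total degree of differences. -/
noncomputable def cc (j : Fin d) : ℕ := ∑ ℓ ∈ Finset.univ.erase j, (α ℓ - α j).natDegree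

/-- The disc around `α j`. -/
def InD (j : Fin d) (x : Lau F) : Prop := ((cc α j - mu α : ℤ) : WithTop ℤ) ≤ v (x - al α j)

variable (hα : Function.Injective α)
    (hdeg : ∀ i j : Fin d, i ≠ j → mu α < (α i - α j).natDegree + cc α j)

include hα in
lemma v_al_sub {i j : Fin d} (h : i ≠ j) :
    v (al α i - al α j) = ((-((α i - α j).natDegree : ℤ) : ℤ) : WithTop ℤ) := by
  rw [al, al, ← map_sub, v_alg]
  exact sub_ne_zero.2 (fun e => h (hα e))

lemma v_al (j : Fin d) : ((-(mu α : ℤ) : ℤ) : WithTop ℤ) ≤ v (al α j) := by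
  by_cases h : α j = 0
  · rw [al, h, map_zero, AddValuation.map_zero]; exact le_top
  · rw [al, v_alg _ h, WithTop.coe_le_coe]
    have : (α j).natDegree ≤ mu α :=
      Finset.le_sup (f := fun ℓ => (α ℓ).natDegree) (Finset.mem_univ j)
    omega

lemma InD.v_ge {j : Fin d} {x : Lau F} (h : InD α j x) : ((-(mu α : ℤ) : ℤ) : WithTop ℤ) ≤ v x := by
  have e : x = (x - al α j) + al α j := by ring
  rw [e]
  refine le_trans (le_min ?_ (v_al α j)) (v.map_add _ _)
  refine le_trans ?_ h
  rw [WithTop.coe_le_coe]; omega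

include hα hdeg in
lemma InD.v_sub {j : Fin d} {x : Lau F} (h : InD α j x) {l : Fin d} (hl : l ≠ j) :
    v (x - al α l) = ((-((α l - α j).natDegree : ℤ) : ℤ) : WithTop ℤ) := by
  have e : x - al α l = (x - al α j) - (al α l - al α j) := by ring
  rw [e, ← v_al_sub α hα hl]
  have h1 := v_al_sub α hα hl
  apply AddValuation.map_sub_eq_of_lt_right
  refine lt_of_lt_of_le ?_ h
  rw [h1, WithTop.coe_lt_coe]
  have := hdeg l j hl
  omega

include hα hdeg in
lemma InD.unique {i j : Fin d} {x : Lau F} (hi : InD α i x) (hj : InD α j x) : i = j := by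
  by_contra hne
  have h1 := InD.v_sub α hα hdeg hj hne
  unfold InD at hi
  rw [h1, WithTop.coe_le_coe] at hi
  have := hdeg j i (Ne.symm hne)
  rw [← neg_sub (α i) (α j), natDegree_neg] at this
  omega

/-- The contraction. -/
noncomputable def GG (j : Fin d) (x y : Lau F) : Lau F :=
  al α j + y / ∏ l ∈ Finset.univ.erase j, (x - al α l)

include hα hdeg in
lemma InD.v_prod {j : Fin d} {x : Lau F} (h : InD α j x) :
    v (∏ l ∈ Finset.univ.erase j, (x - al α l)) = ((-(cc α j : ℤ) : ℤ) : WithTop ℤ) := by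
  rw [v_prod_eq v _ _ (fun l => -((α l - α j).natDegree : ℤ))
    (fun l hl => InD.v_sub α hα hdeg h (Finset.ne_of_mem_erase hl))]
  rw [cc, Finset.sum_neg_distrib]; push_cast; rfl

include hα hdeg in
lemma InD.prod_ne {j : Fin d} {x : Lau F} (h : InD α j x) :
    ∏ l ∈ Finset.univ.erase j, (x - al α l) ≠ 0 := by
  intro h0
  have := InD.v_prod α hα hdeg h
  rw [h0, AddValuation.map_zero] at this
  exact WithTop.coe_ne_top this.symm

lemma v_div_ge {x y : Lau F} {n m : ℤ} (hx : (n : WithTop ℤ) ≤ v x) (hy : v y = (m : WithTop ℤ)) :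
    ((n - m : ℤ) : WithTop ℤ) ≤ v (x / y) := by
  have hy0 : y ≠ 0 := by
    rintro rfl
    rw [AddValuation.map_zero] at hy
    exact WithTop.coe_ne_top hy.symm
  by_cases hx0 : x = 0
  · rw [hx0, zero_div, AddValuation.map_zero]; exact le_top
  obtain ⟨l, hl⟩ := v_int v _ (div_ne_zero hx0 hy0)
  have e := congrArg v (div_mul_cancel₀ x hy0)
  rw [v.map_mul, hl, hy, ← WithTop.coe_add] at e
  rw [← e, WithTop.coe_le_coe] at hx
  rw [hl, WithTop.coe_le_coe]; omega

include hα hdeg in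
lemma GG_mem {j : Fin d} {x y : Lau F} (h : InD α j x) (hy : ((-(mu α : ℤ) : ℤ) : WithTop ℤ) ≤ v y) :
    InD α j (GG α j x y) := by
  unfold InD GG
  rw [add_sub_cancel_left]
  refine le_trans ?_ (v_div_ge hy (InD.v_prod α hα hdeg h))
  rw [WithTop.coe_le_coe]; omega

include hα hdeg in
lemma GG_contr (hd : 1 < d) {j : Fin d} {x y x' y' : Lau F} (h : InD α j x) (h' : InD α j x')
    (hy' : ((-(mu α : ℤ) : ℤ) : WithTop ℤ) ≤ v y') (n : ℤ)
    (hx : (n : WithTop ℤ) ≤ v (x - x')) (hyy : (n : WithTop ℤ) ≤ v (y - y')) :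
    ((n + 1 : ℤ) : WithTop ℤ) ≤ v (GG α j x y - GG α j x' y') := by
  have hc : 1 ≤ cc α j := by
    have : Nontrivial (Fin d) := Fin.nontrivial_iff_two_le.2 hd
    obtain ⟨i, hi⟩ := exists_ne j
    have h1 := hdeg i j hi
    have h2 : (α i - α j).natDegree ≤ mu α := by
      refine (natDegree_sub_le _ _).trans (max_le ?_ ?_)
      · exact Finset.le_sup (f := fun ℓ => (α ℓ).natDegree) (Finset.mem_univ i)
      · exact Finset.le_sup (f := fun ℓ => (α ℓ).natDegree) (Finset.mem_univ j)
    omega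
  have hP := InD.v_prod α hα hdeg h
  have hP' := InD.v_prod α hα hdeg h'
  have hn := InD.prod_ne α hα hdeg h
  have hn' := InD.prod_ne α hα hdeg h'
  have hsub := (v_prod_sub v (Finset.univ.erase j) (fun l => x' - al α l) (fun l => x - al α l)
    (fun l => ((α l - α j).natDegree : ℤ)) n (mu α + 1 - cc α j)
    (fun l hl => (InD.v_sub α hα hdeg h' (Finset.ne_of_mem_erase hl)).ge)
    (fun l hl => (InD.v_sub α hα hdeg h (Finset.ne_of_mem_erase hl)).ge)
    (fun l hl => by
      have e : x' - al α l - (x - al α l) = x' - x := by ring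
      rw [e, AddValuation.map_sub_swap]; exact hx)
    (fun l hl => by have := hdeg l j (Finset.ne_of_mem_erase hl); omega)).1
  have hcc : ∑ l ∈ Finset.univ.erase j, ((α l - α j).natDegree : ℤ) = cc α j := by
    rw [cc]; push_cast; rfl
  rw [hcc] at hsub
  unfold GG
  set Q := ∏ l ∈ Finset.univ.erase j, (x - al α l)
  set Q' := ∏ l ∈ Finset.univ.erase j, (x' - al α l)
  have e : al α j + y / Q - (al α j + y' / Q') = (y - y') / Q + y' * (Q' - Q) / (Q * Q') := by
    field_simp; ring
  rw [e]
  refine le_trans (le_min ?_ ?_) (v.map_add _ _)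
  · refine le_trans ?_ (v_div_ge hyy hP)
    rw [WithTop.coe_le_coe]; omega
  · have h1 : v (Q * Q') = ((-(cc α j : ℤ) + -(cc α j : ℤ) : ℤ) : WithTop ℤ) := by
      rw [v.map_mul, hP, hP', ← WithTop.coe_add]
    have h2 := add_le_add hy' hsub
    rw [← WithTop.coe_add, ← v.map_mul] at h2
    refine le_trans ?_ (v_div_ge h2 h1)
    rw [WithTop.coe_le_coe]; omega

include hα hdeg in
lemma dyn1 (hd : 1 < d) {ι : Type*} (w : ι → Fin d) (nx : ι → ι) :
    ∃ y : ι → Lau F, ∀ i, ∏ l, (y i - al α l) = y (nx i) ∧ InD α (w i) (y i) := by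
  let x : ℕ → ι → Lau F := fun t => Nat.rec (fun i => al α (w i))
    (fun _ x i => GG α (w i) (x i) (x (nx i))) t
  have hx0 : ∀ i, x 0 i = al α (w i) := fun i => rfl
  have hxs : ∀ t i, x (t + 1) i = GG α (w i) (x t i) (x t (nx i)) := fun t i => rfl
  have hD : ∀ t i, InD α (w i) (x t i) := by
    intro t
    induction t with
    | zero => intro i; unfold InD; rw [hx0, sub_self, AddValuation.map_zero]; exact le_top
    | succ t ih => intro i; rw [hxs]; exact GG_mem α hα hdeg (ih i) ((ih (nx i)).v_ge)
  have hstep : ∀ (t : ℕ) i, ((t - mu α : ℤ) : WithTop ℤ) ≤ v (x (t + 1) i - x t i) := by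
    intro t
    induction t with
    | zero =>
      intro i
      refine le_trans (le_min ?_ ?_) (v.map_sub _ _)
      · have := (hD 1 i).v_ge; simpa using this
      · have := (hD 0 i).v_ge; simpa using this
    | succ t ih =>
      intro i
      rw [hxs (t + 1), hxs t]
      have := GG_contr α hα hdeg hd (hD (t + 1) i) (hD t i) ((hD t (nx i)).v_ge) _ (ih i) (ih (nx i))
      refine le_trans ?_ this
      rw [WithTop.coe_le_coe]; push_cast; omega
  choose y hy using fun i => Lau.complete (fun t => x t i) (mu α) (fun t => hstep t i)
  have hyD : ∀ i, InD α (w i) (y i) := by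
    intro i
    have e : y i - al α (w i) = (y i - x (cc α (w i)) i) + (x (cc α (w i)) i - al α (w i)) := by ring
    unfold InD
    rw [e]
    exact le_trans (le_min (hy i _) (hD _ i)) (v.map_add _ _)
  have hfix : ∀ i, y i = GG α (w i) (y i) (y (nx i)) := by
    intro i
    apply sub_eq_zero.1
    apply eq_zero_of_le
    intro N
    have h1 := hy i (N + mu α + 1)
    have h2 := GG_contr α hα hdeg hd (hD (N + mu α) i) (hyD i) ((hyD (nx i)).v_ge) (N : ℤ)
      (by
        rw [AddValuation.map_sub_swap]
        refine le_trans ?_ (hy i (N + mu α))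
        rw [WithTop.coe_le_coe]; push_cast; omega)
      (by
        rw [AddValuation.map_sub_swap]
        refine le_trans ?_ (hy (nx i) (N + mu α))
        rw [WithTop.coe_le_coe]; push_cast; omega)
    rw [← hxs] at h2
    have e : y i - GG α (w i) (y i) (y (nx i)) = (y i - x (N + mu α + 1) i)
      + (x (N + mu α + 1) i - GG α (w i) (y i) (y (nx i))) := by ring
    rw [e]
    refine le_trans (le_min ?_ ?_) (v.map_add _ _)
    · refine le_trans ?_ h1
      rw [WithTop.coe_le_coe]; push_cast; omega
    · refine le_trans ?_ h2
      rw [WithTop.coe_le_coe]; omega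
  refine ⟨y, fun i => ⟨?_, hyD i⟩⟩
  have hn := InD.prod_ne α hα hdeg (hyD i)
  rw [← Finset.mul_prod_erase _ _ (Finset.mem_univ (w i))]
  have h1 : y i - al α (w i) = y (nx i) / ∏ l ∈ Finset.univ.erase (w i), (y i - al α l) := by
    rw [sub_eq_iff_eq_add, add_comm]; exact hfix i
  rw [h1, div_mul_cancel₀ _ hn]

/-- The universal polynomial. -/
noncomputable def fU : F[X][X] := ∏ i, (X - C (α i))

/-- Its iterates. -/
noncomputable def itU (n : ℕ) : F[X][X] := (fU α).comp^[n] X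

lemma fU_monic : (fU α).Monic := monic_prod_X_sub_C _ _

lemma fU_natDegree : (fU α).natDegree = d := by
  rw [fU, natDegree_finsetProd_X_sub_C_eq_card]; simp

lemma itU_natDegree (n : ℕ) : (itU α n).natDegree = d ^ n := by
  rw [itU, natDegree_iterate_comp, fU_natDegree, natDegree_X, mul_one]

lemma itU_monic (hd : 1 < d) (n : ℕ) : (itU α n).Monic := by
  induction n with
  | zero => exact monic_X
  | succ n ih =>
    have : itU α (n + 1) = (fU α).comp (itU α n) := Function.iterate_succ_apply' _ _ _
    rw [this]
    refine (fU_monic α).comp ih ?_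
    rw [itU_natDegree]
    positivity

lemma itU_eval {S : Type*} [CommRing S] (j : F[X] →+* S) (x : S) (n : ℕ) :
    (itU α n).eval₂ j x = (fun z => ∏ i, (z - j (α i)))^[n] x := by
  induction n with
  | zero => simp [itU]
  | succ n ih =>
    have : itU α (n + 1) = (fU α).comp (itU α n) := Function.iterate_succ_apply' _ _ _
    rw [this, eval₂_comp, ih, Function.iterate_succ_apply', fU, eval₂_finsetProd]
    simp

include hα hdeg in
lemma dyn2 (hd : 1 < d) (n m : ℕ) (hmn : m < n) :
    (itU α n - itU α m).Monic ∧ ∃ R : (Fin n → Fin d) → Lau F, Function.Injective R ∧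
      (∀ w, ((-(mu α : ℤ) : ℤ) : WithTop ℤ) ≤ v (R w)) ∧
      (itU α n - itU α m).map (algebraMap F[X] (Lau F)) = ∏ w, (X - C (R w)) := by
  have hlt : (itU α m).degree < (itU α n).degree := by
    rw [degree_eq_natDegree (itU_monic α hd m).ne_zero,
      degree_eq_natDegree (itU_monic α hd n).ne_zero, itU_natDegree, itU_natDegree]
    exact_mod_cast Nat.pow_lt_pow_right hd hmn
  have hmon : (itU α n - itU α m).Monic := (itU_monic α hd n).sub_of_left hlt
  refine ⟨hmon, ?_⟩
  have hn0 : 0 < n := by omega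
  let nx : Fin n → Fin n := fun i => if h : i.1 + 1 < n then ⟨i.1 + 1, h⟩ else ⟨m, hmn⟩
  choose y hy using fun w : Fin n → Fin d => dyn1 α hα hdeg hd w nx
  let f : Lau F → Lau F := fun z => ∏ l, (z - al α l)
  have hit : ∀ w (i : ℕ) (hi : i < n), f^[i] (y w ⟨0, hn0⟩) = y w ⟨i, hi⟩ := by
    intro w i
    induction i with
    | zero => intro hi; rfl
    | succ i ih =>
      intro hi
      rw [Function.iterate_succ_apply', ih (by omega)]
      change ∏ l, _ = _
      rw [(hy w _).1]
      congr 1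
      change (if h : i + 1 < n then (⟨i + 1, h⟩ : Fin n) else ⟨m, hmn⟩) = _
      rw [dif_pos hi]
  have hend : ∀ w, f^[n] (y w ⟨0, hn0⟩) = f^[m] (y w ⟨0, hn0⟩) := by
    intro w
    obtain ⟨n', rfl⟩ : ∃ n', n = n' + 1 := ⟨n - 1, by omega⟩
    rw [Function.iterate_succ_apply', hit w n' (by omega), hit w m hmn]
    change ∏ l, _ = _
    rw [(hy w _).1]
    congr 1
    change (if h : n' + 1 < n' + 1 then (⟨n' + 1, h⟩ : Fin (n' + 1)) else ⟨m, hmn⟩) = _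
    rw [dif_neg (lt_irrefl _)]
  have hinj : Function.Injective (fun w => y w ⟨0, hn0⟩) := by
    intro w w' h
    funext i
    have h1 := hit w i.1 i.2
    have h2 := hit w' i.1 i.2
    change y w ⟨0, hn0⟩ = y w' ⟨0, hn0⟩ at h
    rw [h, h2] at h1
    have h3 := (hy w i).2
    have h4 := (hy w' i).2
    have h5 : y w' i = y w i := h1
    rw [h5] at h4
    exact InD.unique α hα hdeg h3 h4
  refine ⟨fun w => y w ⟨0, hn0⟩, hinj, fun w => (hy w _).2.v_ge, ?_⟩
  apply eq_of_monic_of_dvd_of_natDegree_le (monic_prod_X_sub_C _ _) (hmon.map _)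
  · apply Finset.prod_dvd_of_coprime
    · intro w _ w' _ hne
      exact pairwise_coprime_X_sub_C hinj hne
    · intro w _
      rw [dvd_iff_isRoot, IsRoot, eval_map, eval₂_sub, itU_eval, itU_eval, sub_eq_zero]
      exact hend w
  · rw [hmon.natDegree_map, natDegree_finsetProd_X_sub_C_eq_card]
    refine (natDegree_sub_le _ _).trans ?_
    rw [itU_natDegree, itU_natDegree]
    simp only [Finset.card_univ, Fintype.card_fun, Fintype.card_fin]
    exact max_le le_rfl (Nat.pow_le_pow_right (by omega) hmn.le)

end Dyn
end SUB
open Polynomial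

namespace SUB

section Count

open Lau

/-- Preperiodic elements have conjugates defined over `Lau F`. -/
lemma root_data {F k κ L : Type*} [Field F] [Field k] [Field κ] [Field L]
    (f : F →+* k)
    [Algebra k[X] κ] [Algebra κ (Lau k)] [IsScalarTower k[X] κ (Lau k)]
    [Algebra k[X] L] [Algebra κ L] [IsScalarTower k[X] κ L]
    {d : ℕ} (hd : 1 < d) (α : Fin d → F[X]) (hα : Function.Injective α)
    (hdeg : ∀ i j, i ≠ j → mu α < (α i - α j).natDegree + cc α j)
    (x : L) (hx : ∃ n m, m < n ∧
      (itU α n - itU α m).eval₂ ((algebraMap k[X] L).comp (mapRingHom f)) x = 0) :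
    IsIntegral κ x ∧ ((minpoly κ x).map (algebraMap κ (Lau k))).Splits ∧ IsSeparable κ x ∧
      (∀ y : Lau k, aeval y (minpoly κ x) = 0 → IsIntegral k[X] y ∧
        ∃ r : Lau F, y = mp f r ∧ ((-(mu α : ℤ) : ℤ) : WithTop ℤ) ≤ v r) := by
  obtain ⟨n, m, hmn, hx⟩ := hx
  obtain ⟨hmon, R, hR, hRv, hprod⟩ := dyn2 α hα hdeg hd n m hmn
  set G := itU α n - itU α m with hG
  set g : F[X] →+* k[X] := mapRingHom f
  set G' : k[X][X] := G.map g with hG'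
  have hmon' : G'.Monic := hmon.map _
  set H : κ[X] := G'.map (algebraMap k[X] κ) with hH
  have hmonH : H.Monic := hmon'.map _
  have hxH : aeval x H = 0 := by
    rw [hH, aeval_map_algebraMap, hG', aeval_def, eval₂_map]
    exact hx
  have hHS : H.map (algebraMap κ (Lau k)) = ∏ w, (X - C (mp f (R w))) := by
    have e : ((algebraMap κ (Lau k)).comp (algebraMap k[X] κ)).comp g
        = (mp f).comp (algebraMap F[X] (Lau F)) := by
      refine RingHom.ext fun p => ?_
      simp only [RingHom.comp_apply, ← IsScalarTower.algebraMap_apply, mp_alg]; rfl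
    rw [hH, hG', Polynomial.map_map, Polynomial.map_map, e, ← Polynomial.map_map, hprod,
      Polynomial.map_prod]
    simp
  have hinj : Function.Injective (fun w => mp f (R w)) := (mp f).injective.comp hR
  have hdvd : minpoly κ x ∣ H := minpoly.dvd κ x hxH
  have hHS0 : H.map (algebraMap κ (Lau k)) ≠ 0 := (hmonH.map _).ne_zero
  refine ⟨⟨H, hmonH, hxH⟩, ?_, ?_, ?_⟩
  · refine Splits.of_dvd ?_ hHS0 ((Polynomial.map_dvd_map' _).2 hdvd)
    rw [hHS]
    exact Splits.prod fun w _ => Splits.X_sub_C _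
  · refine Separable.of_dvd ?_ hdvd
    rw [← separable_map (algebraMap κ (Lau k)), hHS]
    exact separable_prod_X_sub_C_iff.2 hinj
  · intro y hy
    have hyH : aeval y H = 0 := by
      obtain ⟨c, hc⟩ := hdvd
      rw [hc, map_mul, hy, zero_mul]
    refine ⟨⟨G', hmon', ?_⟩, ?_⟩
    · rw [hH, aeval_map_algebraMap] at hyH; exact hyH
    · rw [aeval_def, ← eval_map, hHS, eval_prod, Finset.prod_eq_zero_iff] at hyH
      obtain ⟨w, _, hw⟩ := hyH
      rw [eval_sub, eval_X, eval_C, sub_eq_zero] at hw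
      exact ⟨R w, hw, hRv w⟩

lemma main_count {F k κ L κT Om : Type*} [Field F] [Fintype F] [Field k] [Field κ] [Field L]
    [Field κT] [Field Om] (f : F →+* k)
    [Algebra k[X] κ] [IsFractionRing k[X] κ] [Algebra κ (Lau k)] [IsScalarTower k[X] κ (Lau k)]
    [Algebra k[X] L] [Algebra κ L] [IsScalarTower k[X] κ L] [Algebra.IsAlgebraic κ L]
    [IsAlgClosed Om] [Algebra (Lau k) Om] [Algebra k[X] Om] [IsScalarTower k[X] (Lau k) Om]
    [Algebra κT L] [FiniteDimensional κT L]
    {d : ℕ} (hd : 1 < d) (α : Fin d → F[X]) (hα : Function.Injective α)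
    (hdeg : ∀ i j, i ≠ j → mu α < (α i - α j).natDegree + cc α j)
    (N : ℕ) (hN : Module.finrank κT L ≤ N)
    (T : L) (hcompat : ∀ ψ ψ' : L →+* Om,
      (∀ c : k, ψ (algebraMap k[X] L (C c)) = ψ' (algebraMap k[X] L (C c))) → ψ T = ψ' T →
      ψ.comp (algebraMap κT L) = ψ'.comp (algebraMap κT L))
    (hT : ∀ p : k[X], p ≠ 0 → p.eval₂ ((algebraMap k[X] L).comp C) T ≠ 0)
    (P : k[X][X]) (hP0 : P ≠ 0) (hPN : ∀ n, (P.coeff n).natDegree ≤ N)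
    (hPT : P.eval₂ (algebraMap k[X] L) T = 0)
    (s : Finset L)
    (hsx : ∀ x ∈ s, ∃ n m, m < n ∧
      (itU α n - itU α m).eval₂ ((algebraMap k[X] L).comp (mapRingHom f)) x = 0) :
    s.card ≤ Fintype.card F ^ ((mu α + 1) * ((Fintype.card F + 1) * (N * N))) := by
  classical
  set q := Fintype.card F with hqdef
  have hq : 0 < q := Fintype.card_pos
  have hq1 : 1 < q := Fintype.one_lt_card
  have hdat := fun x (hx : x ∈ s) =>
    root_data (κ := κ) f hd α hα hdeg x (hsx x hx)
  let B := IntermediateField.adjoin κ (s : Set L)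
  haveI : FiniteDimensional κ B :=
    IntermediateField.finiteDimensional_adjoin (fun x hx => (hdat x hx).1)
  haveI : Algebra.IsSeparable κ B :=
    (IntermediateField.isSeparable_adjoin_iff_isSeparable κ L).2 (fun x hx => (hdat x hx).2.2.1)
  have hs : ∀ x : B, ((minpoly κ x).map (algebraMap κ (Lau k))).Splits := by
    intro x
    rw [IntermediateField.minpoly_eq]
    exact IntermediateField.splits_of_mem_adjoin κ L
      (fun x hx => ⟨(hdat x hx).1, (hdat x hx).2.1⟩) x.2
  have hsub : ∀ x ∈ s, x ∈ B := fun x hx => IntermediateField.subset_adjoin κ _ hx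
  have hτ : ∀ (τ : B →ₐ[κ] Lau k) (x : L) (hx : x ∈ s),
      IsIntegral k[X] (τ ⟨x, hsub x hx⟩) ∧ ∃ r : Lau F, τ ⟨x, hsub x hx⟩ = mp f r ∧
        ((-(mu α : ℤ) : ℤ) : WithTop ℤ) ≤ v r := by
    intro τ x hx
    apply (hdat x hx).2.2.2
    have : minpoly κ x = minpoly κ (⟨x, hsub x hx⟩ : B) :=
      (IntermediateField.minpoly_eq (⟨x, hsub x hx⟩ : B)).symm
    rw [this, aeval_algHom_apply, minpoly.aeval, map_zero]
  have hexp : ∀ p : k[X], p ≠ 0 → expand k q p ≠ 0 := fun p hp => (expand_ne_zero hq).2 hp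
  have hB : ∀ b : B, ∃ b' : B, ∀ τ : B →ₐ[κ] Lau k, τ b' = Phi q hq (τ b) := by
    rintro ⟨b, hb⟩
    refine IntermediateField.adjoin_induction κ
      (p := fun b hb => ∃ b' : B, ∀ τ : B →ₐ[κ] Lau k, τ b' = Phi q hq (τ ⟨b, hb⟩))
      ?_ ?_ ?_ ?_ ?_ hb
    · intro x hx
      refine ⟨⟨x, hsub x hx⟩ ^ q, fun τ => ?_⟩
      obtain ⟨_, r, hr, _⟩ := hτ τ x hx
      rw [map_pow, hr, mp_Phi, Phi_frob, map_pow]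
    · intro c
      obtain ⟨a, e, he, rfl⟩ := IsFractionRing.div_surjective (A := k[X]) c
      refine ⟨algebraMap κ B (algebraMap k[X] κ (expand k q a) / algebraMap k[X] κ (expand k q e)),
        fun τ => ?_⟩
      have : (⟨algebraMap κ L (algebraMap k[X] κ a / algebraMap k[X] κ e),
        B.algebraMap_mem _⟩ : B) = algebraMap κ B (algebraMap k[X] κ a / algebraMap k[X] κ e) := rfl
      rw [this, τ.commutes, τ.commutes, map_div₀, map_div₀, map_div₀,
        ← IsScalarTower.algebraMap_apply, ← IsScalarTower.algebraMap_apply,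
        ← IsScalarTower.algebraMap_apply, ← IsScalarTower.algebraMap_apply, Phi_alg, Phi_alg]
    · rintro x y hx hy ⟨x', h1⟩ ⟨y', h2⟩
      refine ⟨x' + y', fun τ => ?_⟩
      have : (⟨x + y, B.add_mem hx hy⟩ : B) = ⟨x, hx⟩ + ⟨y, hy⟩ := rfl
      rw [this, map_add, map_add, map_add, h1, h2]
    · rintro x hx ⟨x', h1⟩
      refine ⟨x'⁻¹, fun τ => ?_⟩
      have : (⟨x⁻¹, B.inv_mem hx⟩ : B) = (⟨x, hx⟩)⁻¹ := rfl
      rw [this, map_inv₀, map_inv₀, map_inv₀, h1]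
    · rintro x y hx hy ⟨x', h1⟩ ⟨y', h2⟩
      refine ⟨x' * y', fun τ => ?_⟩
      have : (⟨x * y, B.mul_mem hx hy⟩ : B) = ⟨x, hx⟩ * ⟨y, hy⟩ := rfl
      rw [this, map_mul, map_mul, map_mul, h1, h2]
  haveI : Algebra.IsAlgebraic B L := Algebra.IsAlgebraic.tower_top (K := κ) B
  have hM : Fintype.card (B →ₐ[κ] Lau k) ≤ (q + 1) * (N * N) := by
    refine core (κT := κT) (Om := Om) (L := L) v N q hN hs v_alg (Phi q hq) (v_Phi q hq)
      (Phi_sub q hq) hq (Phi_alg q hq) (Phi_fix q hq hq1) hB (algebraMap k[X] L) ?_ T hcompat hT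
      P hP0 hPN hPT
    refine RingHom.ext fun p => ?_
    exact IsScalarTower.algebraMap_apply k[X] κ L p
  have hM0 : 0 < Fintype.card (B →ₐ[κ] Lau k) := by
    rw [AlgHom.card_of_splits κ B (Lau k) hs]; exact Module.finrank_pos
  choose hint r hr hrv using hτ
  let code : s → ((B →ₐ[κ] Lau k) → Fin (mu α + 1) → F) :=
    fun x τ i => cf (r τ x.1 x.2) (-(i : ℤ))
  have hcode : Function.Injective code := by
    rintro ⟨x, hx⟩ ⟨y, hy⟩ h
    by_contra hne
    have hz : (⟨x, hsub x hx⟩ - ⟨y, hsub y hy⟩ : B) ≠ 0 := by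
      intro h0
      apply hne
      rw [sub_eq_zero] at h0
      have h1 : x = y := congrArg (fun b : B => (b : L)) h0
      exact Subtype.ext h1
    have h1 := norm_le (k := k) v hs v_alg _ hz 1 one_ne_zero (by
      rw [map_one, one_mul]
      refine IsIntegral.prod _ fun τ _ => ?_
      rw [map_sub]
      exact (hint τ x hx).sub (hint τ y hy))
    rw [map_one, one_mul] at h1
    have h2 := v_prod_le v Finset.univ
      (fun τ : B →ₐ[κ] Lau k => τ (⟨x, hsub x hx⟩ - ⟨y, hsub y hy⟩ : B)) (fun _ => 1) (by
      intro τ _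
      rw [map_sub, hr τ x hx, hr τ y hy, ← map_sub, le_v]
      intro m hm
      rw [cf_mp, cf_sub]
      by_cases hm2 : m < -(mu α : ℤ)
      · rw [le_v.1 (hrv τ x hx) m hm2, le_v.1 (hrv τ y hy) m hm2, sub_zero, map_zero]
      · have := congrFun (congrFun h τ) ⟨(-m).toNat, by omega⟩
        simp only [code] at this
        have e : (-(((-m).toNat : ℕ) : ℤ)) = m := by omega
        rw [e] at this
        rw [this, sub_self, map_zero])
    have h3 := h2.trans h1
    rw [Finset.sum_const, Finset.card_univ, nsmul_one] at h3
    have h4 : ((Fintype.card (B →ₐ[κ] Lau k) : ℤ)) ≤ 0 := by exact_mod_cast h3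
    omega
  have h5 := Fintype.card_le_of_injective code hcode
  rw [Fintype.card_coe, Fintype.card_fun, Fintype.card_fun, Fintype.card_fin, ← pow_mul] at h5
  refine h5.trans (Nat.pow_le_pow_right hq ?_)
  exact Nat.mul_le_mul_left _ hM

end Count
end SUB
open Polynomial

namespace SUB

section Final

open Lau

lemma swap_poly {k L : Type*} [Field k] [Field L] (ι : k →+* L) (σ T : L) (Q : k[X][X]) (hQ : Q ≠ 0)
    (N : ℕ) (hN : Q.natDegree ≤ N) :
    ∃ P : k[X][X], P ≠ 0 ∧ (∀ n, (P.coeff n).natDegree ≤ N) ∧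
      P.eval₂ (eval₂RingHom ι σ) T = Q.eval₂ (eval₂RingHom ι T) σ := by
  let P : k[X][X] := ∑ i ∈ Finset.range (N + 1), (Q.coeff i).map C * C (X ^ i)
  have hc : ∀ n, P.coeff n = ∑ i ∈ Finset.range (N + 1), C ((Q.coeff i).coeff n) * X ^ i := by
    intro n
    simp only [P, finsetSum_coeff, coeff_mul_C, coeff_map]
  refine ⟨P, ?_, ?_, ?_⟩
  · intro h0
    apply hQ
    ext i n
    by_cases hi : i ≤ N
    · have := hc n
      rw [h0, coeff_zero] at this
      have h1 := congrArg (fun p : k[X] => p.coeff i) this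
      simp only [finsetSum_coeff, coeff_C_mul, coeff_X_pow, coeff_zero, mul_ite, mul_one,
        mul_zero, Finset.sum_ite_eq, Finset.mem_range] at h1
      rw [if_pos (by omega)] at h1
      rw [← h1]; rfl
    · rw [coeff_eq_zero_of_natDegree_lt (by omega : Q.natDegree < i)]; rfl
  · intro n
    rw [hc]
    apply natDegree_sum_le_of_forall_le
    intro i hi
    refine (natDegree_C_mul_X_pow_le _ _).trans ?_
    rw [Finset.mem_range] at hi; omega
  · rw [eval₂_eq_sum_range' _ (by omega : Q.natDegree < N + 1), eval₂_finsetSum]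
    refine Finset.sum_congr rfl fun i _ => ?_
    rw [eval₂_mul, eval₂_C, eval₂_map]
    congr 1
    · have : (eval₂RingHom ι σ).comp C = ι := by ext; simp
      rw [this]; rfl
    · simp

lemma alg_L {k κ L : Type*} [Field k] [Field κ] [Field L] [Algebra (RatFunc k) L]
    [FiniteDimensional (RatFunc k) L] [Algebra κ L]
    (hk : ∀ c : k, algebraMap (RatFunc k) L (RatFunc.C c) ∈ algebraicClosure κ L)
    (hT : algebraMap (RatFunc k) L RatFunc.X ∈ algebraicClosure κ L) :
    Algebra.IsAlgebraic κ L := by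
  set A := algebraicClosure κ L with hA
  have hp : ∀ p : k[X], algebraMap (RatFunc k) L (algebraMap k[X] (RatFunc k) p) ∈ A := by
    intro p
    induction p using Polynomial.induction_on' with
    | add p q hp hq => rw [map_add, map_add]; exact A.add_mem hp hq
    | monomial n a =>
      rw [← C_mul_X_pow_eq_monomial, map_mul, map_mul, map_pow, map_pow, RatFunc.algebraMap_C,
        RatFunc.algebraMap_X]
      exact A.mul_mem (hk a) (pow_mem hT n)
  have hr : ∀ r : RatFunc k, algebraMap (RatFunc k) L r ∈ A := by
    intro r
    obtain ⟨a, e, he, rfl⟩ := IsFractionRing.div_surjective (A := k[X]) r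
    rw [map_div₀]
    exact A.div_mem (hp a) (hp e)
  let φ : RatFunc k →+* A := (algebraMap (RatFunc k) L).codRestrict A hr
  refine ⟨fun y => ?_⟩
  haveI : Algebra.IsAlgebraic κ A := algebraicClosure.isAlgebraic κ L
  have hy : IsIntegral (RatFunc k) y := Algebra.IsIntegral.isIntegral y
  refine IsAlgebraic.restrictScalars κ (S := A) ⟨(minpoly (RatFunc k) y).map φ, ?_, ?_⟩
  · exact ((minpoly.monic hy).map _).ne_zero
  · rw [aeval_def, eval₂_map]
    exact minpoly.aeval (RatFunc k) y

lemma final_count {F k L : Type} [Field F] [Fintype F] [Field k] [Field L] (f : F →+* k)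
    [Algebra (RatFunc k) L] [FiniteDimensional (RatFunc k) L]
    {d : ℕ} (hd : 1 < d) (α : Fin d → F[X]) (hα : Function.Injective α)
    (hdeg : ∀ i j, i ≠ j → mu α < (α i - α j).natDegree + cc α j)
    (N : ℕ) (hN : Module.finrank (RatFunc k) L ≤ N) (ι : k →+* L)
    (hι : ι = (algebraMap (RatFunc k) L).comp RatFunc.C)
    (σ : L) (hσ : ∀ p : k[X], p ≠ 0 → p.eval₂ ι σ ≠ 0)
    (s : Finset L)
    (hsx : ∀ x ∈ s, ∃ n m, m < n ∧
      (fun z => ∏ i, (z - (α i).eval₂ (ι.comp f) σ))^[n] x =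
        (fun z => ∏ i, (z - (α i).eval₂ (ι.comp f) σ))^[m] x) :
    s.card ≤ Fintype.card F ^ ((mu α + 1) * ((Fintype.card F + 1) * (N * N))) := by
  let jL : k[X] →+* L := eval₂RingHom ι σ
  have hjL : Function.Injective jL := by
    rw [injective_iff_map_eq_zero]
    intro p hp
    by_contra h
    exact hσ p h hp
  letI a1 : Algebra k[X] L := jL.toAlgebra
  haveI : FaithfulSMul k[X] L := (faithfulSMul_iff_algebraMap_injective _ _).2 hjL
  letI a2 : Algebra (FractionRing k[X]) L := FractionRing.liftAlgebra k[X] L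
  haveI : IsScalarTower k[X] (FractionRing k[X]) L := FractionRing.isScalarTower_liftAlgebra k[X] L
  haveI : FaithfulSMul k[X] (Lau k) := by
    refine (faithfulSMul_iff_algebraMap_injective _ _).2 ?_
    rw [injective_iff_map_eq_zero]
    intro p hp
    by_contra h
    have := v_alg p h
    rw [hp, v.map_zero] at this
    exact WithTop.coe_ne_top this.symm
  letI a3 : Algebra (FractionRing k[X]) (Lau k) := FractionRing.liftAlgebra k[X] (Lau k)
  haveI : IsScalarTower k[X] (FractionRing k[X]) (Lau k) :=
    FractionRing.isScalarTower_liftAlgebra k[X] (Lau k)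
  let T : L := algebraMap (RatFunc k) L RatFunc.X
  have hιT : ∀ p : k[X], p.eval₂ ι T = algebraMap (RatFunc k) L (algebraMap k[X] (RatFunc k) p) := by
    intro p
    induction p using Polynomial.induction_on' with
    | add p q hp hq => rw [map_add, map_add, eval₂_add, hp, hq]
    | monomial n a =>
      rw [eval₂_monomial, ← C_mul_X_pow_eq_monomial, map_mul, map_mul, map_pow, map_pow,
        RatFunc.algebraMap_C, RatFunc.algebraMap_X, hι]
      rfl
  have hjC : ∀ c, jL (C c) = ι c := fun c => by simp [jL]
  have hjC' : jL.comp C = ι := RingHom.ext hjC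
  have hTtr : ∀ p : k[X], p ≠ 0 → p.eval₂ ι T ≠ 0 := by
    intro p hp
    rw [hιT]
    intro h
    rw [map_eq_zero_iff _ (algebraMap (RatFunc k) L).injective,
      map_eq_zero_iff _ (IsFractionRing.injective k[X] (RatFunc k))] at h
    exact hp h
  -- the polynomial relation
  have hσint : IsIntegral (RatFunc k) σ := Algebra.IsIntegral.isIntegral σ
  let Q : k[X][X] := IsLocalization.integerNormalization (nonZeroDivisors k[X])
    (minpoly (RatFunc k) σ)
  have hQ0 : Q ≠ 0 := fun h =>
    minpoly.ne_zero hσint (IsFractionRing.integerNormalization_eq_zero_iff.1 h)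
  have hQN : Q.natDegree ≤ N := by
    refine le_trans ?_ ((minpoly.natDegree_le (A := RatFunc k) σ).trans hN)
    rw [natDegree_le_iff_coeff_eq_zero]
    intro n hn
    by_contra h
    have := IsLocalization.integerNormalization_support (nonZeroDivisors k[X])
      (minpoly (RatFunc k) σ) (mem_support_iff.2 h)
    exact mem_support_iff.1 this (coeff_eq_zero_of_natDegree_lt hn)
  have hQe : Q.eval₂ (eval₂RingHom ι T) σ = 0 := by
    have := IsLocalization.integerNormalization_eval₂_eq_zero (nonZeroDivisors k[X])
      (algebraMap (RatFunc k) L) (minpoly (RatFunc k) σ) (x := σ) (minpoly.aeval _ _)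
    have e : eval₂RingHom ι T = (algebraMap (RatFunc k) L).comp (algebraMap k[X] (RatFunc k)) :=
      RingHom.ext hιT
    rw [e]; exact this
  obtain ⟨P, hP0, hPN, hPe⟩ := swap_poly ι σ T Q hQ0 N hQN
  rw [hQe] at hPe
  haveI : Algebra.IsAlgebraic (FractionRing k[X]) L := by
    apply alg_L (k := k)
    · intro c
      have : algebraMap (RatFunc k) L (RatFunc.C c)
          = algebraMap (FractionRing k[X]) L (algebraMap k[X] (FractionRing k[X]) (C c)) := by
        rw [← IsScalarTower.algebraMap_apply]
        change _ = jL (C c)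
        rw [hjC, hι]; rfl
      rw [this]
      exact (algebraicClosure (FractionRing k[X]) L).algebraMap_mem _
    · rw [mem_algebraicClosure_iff]
      refine ⟨P.map (algebraMap k[X] (FractionRing k[X])), ?_, ?_⟩
      · rwa [Ne, Polynomial.map_eq_zero_iff (IsFractionRing.injective k[X] (FractionRing k[X]))]
      · rw [aeval_map_algebraMap]; exact hPe
  refine main_count (κ := FractionRing k[X]) (κT := RatFunc k) (Om := AlgebraicClosure (Lau k))
    f hd α hα hdeg N hN T ?_ ?_ P hP0 hPN hPe s ?_
  · intro ψ ψ' h1 h2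
    apply IsLocalization.ringHom_ext (nonZeroDivisors k[X])
    apply Polynomial.ringHom_ext
    · intro c
      have := h1 c
      change ψ (jL (C c)) = ψ' (jL (C c)) at this
      rw [hjC, hι] at this
      simp only [RingHom.comp_apply, RatFunc.algebraMap_C]
      exact this
    · simp only [RingHom.comp_apply, RatFunc.algebraMap_X]
      exact h2
  · intro p hp
    change p.eval₂ (jL.comp C) T ≠ 0
    rw [hjC']; exact hTtr p hp
  · intro x hx
    obtain ⟨n, m, hmn, h⟩ := hsx x hx
    refine ⟨n, m, hmn, ?_⟩
    rw [eval₂_sub, itU_eval, itU_eval, sub_eq_zero]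
    have e : ∀ i, (algebraMap k[X] L).comp (mapRingHom f) (α i) = (α i).eval₂ (ι.comp f) σ := by
      intro i
      change ((α i).map f).eval₂ ι σ = _
      rw [eval₂_map]
    simp only [e]
    exact h

lemma isotrivial_of_alg {k L : Type} [Field k] [Field L] (ι : k →+* L) {d : ℕ} (hd : 1 < d)
    (a : Fin d → L) (ha : ∀ i, ∃ p : k[X], p ≠ 0 ∧ p.eval₂ ι (a i) = 0) :
    IsotrivialMap ι (polyP1Map (∏ i, (X - C (a i)))) := by
  letI : Algebra k L := ι.toAlgebra
  have hmem : ∀ i, a i ∈ algebraicClosure k L := by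
    intro i
    obtain ⟨p, hp, h⟩ := ha i
    exact mem_algebraicClosure_iff.2 ⟨p, hp, h⟩
  have hA : ∀ x ∈ algebraicClosure k L, AlgebraicOver ι x := by
    intro x hx
    obtain ⟨p, hp, h⟩ := mem_algebraicClosure_iff.1 hx
    refine ⟨p, hp, ?_⟩
    rw [IsRoot, eval_map]; exact h
  have hid : mobiusMap (1 : L) 0 0 1 = id := by
    funext x
    cases x with
    | none => simp [mobiusMap, ratP1Map]
    | some x => simp [mobiusMap, ratP1Map]
  refine ⟨1, 0, 0, 1, by simp, ∏ i, (X - C (a i)), 1, one_ne_zero, ?_, ?_, ?_⟩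
  · intro n
    apply hA
    have : (∏ i, (X - C (a i)) : L[X]) =
        (∏ i, (X - C (⟨a i, hmem i⟩ : algebraicClosure k L))).map
          (algebraMap (algebraicClosure k L) L) := by
      rw [Polynomial.map_prod]; simp
    rw [this, coeff_map]
    exact Subtype.mem _
  · intro n
    apply hA
    rw [coeff_one]
    split_ifs
    · exact one_mem _
    · exact zero_mem _
  · rw [neg_zero, hid, Function.id_comp, Function.comp_id]
    funext x
    cases x with
    | none =>
      have : (1 : L[X]).degree < (∏ i, (X - C (a i)) : L[X]).degree := by
        rw [degree_one, degree_prod]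
        simp only [degree_X_sub_C, Finset.sum_const, Finset.card_univ, Fintype.card_fin, nsmul_one]
        exact_mod_cast (by omega : 0 < d)
      simp only [polyP1Map, ratP1Map, if_pos this]
    | some x => simp [polyP1Map, ratP1Map]

lemma preper_some {L : Type} [Field L] (g : L[X]) (x : L)
    (h : IsPreperiodic (polyP1Map g) (some x)) :
    ∃ n m, m < n ∧ (fun z => g.eval z)^[n] x = (fun z => g.eval z)^[m] x := by
  have hit : ∀ n, (polyP1Map g)^[n] (some x) = some ((fun z => g.eval z)^[n] x) := by
    intro n
    induction n with
    | zero => rfl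
    | succ n ih => rw [Function.iterate_succ_apply', ih, Function.iterate_succ_apply']; rfl
  have hni : ¬ Function.Injective (fun n : ℕ => (polyP1Map g)^[n] (some x)) := fun hi =>
    Set.infinite_range_of_injective hi h
  rw [Function.Injective] at hni
  push Not at hni
  obtain ⟨a, b, hab, hne⟩ := hni
  simp only [hit, Option.some.injEq] at hab
  rcases lt_or_gt_of_ne hne with h' | h'
  · exact ⟨b, a, h', hab.symm⟩
  · exact ⟨a, b, h', hab⟩

lemma finite_of_bound {L : Type} (Z : Set (Option L)) (M : ℕ)
    (h : ∀ s : Finset L, (∀ x ∈ s, some x ∈ Z) → s.card ≤ M) :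
    Z.Finite ∧ Z.ncard ≤ M + 1 := by
  classical
  have key : ∀ t : Finset (Option L), (t : Set (Option L)) ⊆ Z → t.card ≤ M + 1 := by
    intro t ht
    have h1 := h t.eraseNone (fun x hx => ht (Finset.mem_eraseNone.1 hx))
    have h2 := Finset.card_le_card (Finset.insertNone_eraseNone t ▸ Finset.subset_insert none t)
    rw [Finset.card_insertNone] at h2
    omega
  have hfin : Z.Finite := by
    by_contra hinf
    obtain ⟨t, ht, hc⟩ := Set.Infinite.exists_subset_card_eq hinf (M + 2)
    have := key t ht
    omega
  refine ⟨hfin, ?_⟩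
  rw [Set.ncard_eq_toFinset_card Z hfin]
  exact key _ (by simp)

end Final
end SUB
/-- Theorem 1.1 of Doyle–Faber.  Let `F = F_q` be a finite field, `d > 1`, and
let `α_1, …, α_d ∈ F_q[t]` be distinct polynomials satisfying the degree inequality.  Then for
every field `k ⊇ F_q`, every function field `K` over `k` (a finite extension of `k(T) = RatFunc k`),
and every `D ≥ 1`, there is a bound `B` such that for every extension `L/K` of degree at most `D`
and every `σ ∈ L` with `f_σ(z) = ∏ (z - α_i(σ))` not isotrivial over `k`, the number of
preperiodic points of `f_σ` in `P¹(L)` is at most `B`. -/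
theorem strong_uniform_boundedness_polynomial_family
    (F : Type) [Field F] [Fintype F]
    (d : ℕ) (hd : 1 < d)
    (α : Fin d → Polynomial F) (hα : Function.Injective α)
    (hdeg : ∀ i j : Fin d, i ≠ j →
      (Finset.univ.sup fun ℓ => (α ℓ).natDegree) <
        (α i - α j).natDegree + ∑ ℓ ∈ Finset.univ.erase j, (α ℓ - α j).natDegree)
    (k : Type) [Field k] [Algebra F k]
    (K : Type) [Field K] [Algebra (RatFunc k) K] [FiniteDimensional (RatFunc k) K]
    (D : ℕ) (hD : 1 ≤ D) :
    ∃ B : ℕ, ∀ (L : Type) [Field L] [Algebra K L] [FiniteDimensional K L],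
      Module.finrank K L ≤ D → ∀ σ : L,
      let ρ : F →+* L :=
        (algebraMap K L).comp ((algebraMap (RatFunc k) K).comp
          (RatFunc.C.comp (algebraMap F k)));
      let ι : k →+* AlgebraicClosure L :=
        (algebraMap L (AlgebraicClosure L)).comp ((algebraMap K L).comp
          ((algebraMap (RatFunc k) K).comp RatFunc.C));
      let fσ : Polynomial L := ∏ i, (X - C (Polynomial.eval₂ ρ σ (α i)));
      ¬ IsotrivialMap ι (polyP1Map (fσ.map (algebraMap L (AlgebraicClosure L)))) →
      ({x : Option L | IsPreperiodic (polyP1Map fσ) x}.Finite ∧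
        {x : Option L | IsPreperiodic (polyP1Map fσ) x}.ncard ≤ B) := by
  classical
  let N := Module.finrank (RatFunc k) K * D
  refine ⟨Fintype.card F ^ ((SUB.mu α + 1) * ((Fintype.card F + 1) * (N * N))) + 1, ?_⟩
  intro L _ _ _ hLD σ ρ ι fσ hiso
  letI : Algebra (RatFunc k) L := ((algebraMap K L).comp (algebraMap (RatFunc k) K)).toAlgebra
  haveI : IsScalarTower (RatFunc k) K L := IsScalarTower.of_algebraMap_eq fun _ => rfl
  haveI : FiniteDimensional (RatFunc k) L := FiniteDimensional.trans (RatFunc k) K L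
  have hN : Module.finrank (RatFunc k) L ≤ N := by
    rw [← Module.finrank_mul_finrank (RatFunc k) K L]
    exact Nat.mul_le_mul_left _ hLD
  let ι₀ : k →+* L := (algebraMap (RatFunc k) L).comp RatFunc.C
  have hσ : ∀ p : k[X], p ≠ 0 → p.eval₂ ι₀ σ ≠ 0 := by
    intro p hp h0
    apply hiso
    have e : fσ.map (algebraMap L (AlgebraicClosure L)) =
        ∏ i, (X - C (algebraMap L (AlgebraicClosure L) (Polynomial.eval₂ ρ σ (α i)))) := by
      simp only [fσ, Polynomial.map_prod, Polynomial.map_sub, map_X, map_C]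
    rw [e]
    apply SUB.isotrivial_of_alg ι hd
    intro i
    letI : Algebra k L := ι₀.toAlgebra
    have h1 : IsAlgebraic k σ := ⟨p, hp, h0⟩
    have h2 : IsAlgebraic k (Polynomial.eval₂ ρ σ (α i)) := by
      have e2 : Polynomial.eval₂ ρ σ (α i) = aeval σ ((α i).map (algebraMap F k)) := by
        rw [aeval_def, eval₂_map]; rfl
      rw [e2]
      have h3 : σ ∈ algebraicClosure k L := mem_algebraicClosure_iff.2 h1
      have h5 := aeval_algebraMap_apply L (⟨σ, h3⟩ : algebraicClosure k L)
        ((α i).map (algebraMap F k))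
      change aeval σ _ = _ at h5
      rw [h5]
      exact mem_algebraicClosure_iff.1 (Subtype.mem _)
    obtain ⟨r, hr, hr0⟩ := h2
    refine ⟨r, hr, ?_⟩
    have h4 := congrArg (algebraMap L (AlgebraicClosure L)) hr0
    rw [aeval_def, hom_eval₂, map_zero] at h4
    exact h4
  apply SUB.finite_of_bound
  intro s hs
  refine SUB.final_count (algebraMap F k) hd α hα hdeg N hN ι₀ rfl σ hσ s ?_
  intro x hx
  obtain ⟨n, m, hmn, h⟩ := SUB.preper_some fσ x (hs x hx)
  refine ⟨n, m, hmn, ?_⟩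
  have e : (fun z => fσ.eval z) = fun z => ∏ i, (z - (α i).eval₂ (ι₀.comp (algebraMap F k)) σ) := by
    funext z
    simp only [fσ, eval_prod, eval_sub, eval_X, eval_C]
    rfl
  rw [e] at h
  exact h
end

section
/- Let F be a field with a nonarchimedean absolute value ‖·‖, let α_1, …, α_d ∈ F be distinct (d ≥ 2), set f(z) = Π_{ℓ=1}^{d} (z − α_ℓ) and R = max_ℓ ‖α_ℓ‖. Fix an index j and set r_j = R / Π_{ℓ ≠ j} ‖α_ℓ − α_j‖, and assume r_j < ‖α_i − α_j‖ for every i ≠ j. Then for every y ∈ F with ‖y‖ ≤ r_j one has ‖f(α_j + y)‖ = ‖y‖ · Π_{ℓ ≠ j} ‖α_j − α_ℓ‖ = (‖y‖ / r_j) · R. Moreover, if F is algebraically closed, then f maps the closed disk D(α_j, r_j) = {x : ‖x − α_j‖ ≤ r_j} onto the closed disk D(0, R) = {w : ‖w‖ ≤ R}. -/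
/-- A nonarchimedean absolute value of a multiset sum is below any common positive bound. -/
lemma na_multiset_sum_lt {F : Type} [Field F] (v : AbsoluteValue F ℝ) (hna : IsNonarchimedean v)
    (c : ℝ) (hc : 0 < c) (s : Multiset F) (h : ∀ x ∈ s, v x < c) : v s.sum < c := by
  induction s using Multiset.induction_on with
  | empty => simpa using hc
  | cons a s ih =>
    rw [Multiset.sum_cons]
    exact lt_of_le_of_lt (hna a s.sum) (max_lt (h a (Multiset.mem_cons_self a s))
      (ih fun x hx => h x (Multiset.mem_cons_of_mem hx)))

/-- Adding a strictly smaller element does not change the absolute value. -/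
lemma na_add_of_lt {F : Type} [Field F] (v : AbsoluteValue F ℝ) (hna : IsNonarchimedean v)
    (a b : F) (h : v b < v a) : v (a + b) = v a := by
  apply le_antisymm
  · exact (hna a b).trans (max_le le_rfl h.le)
  · by_contra! hlt
    have h1 := hna (a + b) (-b)
    rw [add_neg_cancel_right, v.map_neg] at h1
    exact absurd h1 (not_le.mpr (max_lt hlt h))

/-- condition (7) in the proof of Theorem 1.1 of Doyle–Faber.  Let `F` be a
field with a nonarchimedean absolute value `v`, let `α₁, …, α_d ∈ F` be distinct (`d ≥ 2`), set
`f(z) = Π (z - α_ℓ)` and let `R = max_ℓ v (α_ℓ)`.  Fix `j` and set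
`r_j = R / Π_{ℓ ≠ j} v (α_ℓ - α_j)`, and assume `r_j < v (α_i - α_j)` for every `i ≠ j`.  Then
for every `y` with `v y ≤ r_j` one has
`v (f (α_j + y)) = v y · Π_{ℓ ≠ j} v (α_j - α_ℓ) = (v y / r_j) · R`; moreover if `F` is
algebraically closed then `f` maps the closed disk `D(α_j, r_j)` onto the closed disk
`D(0, R)`. -/
theorem maps_disk_onto_disk_poly
    {F : Type} [Field F] (v : AbsoluteValue F ℝ) (hna : IsNonarchimedean v)
    (d : ℕ) (hd : 2 ≤ d) (α : Fin d → F) (hinj : Function.Injective α)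
    (R : ℝ) (hRmax : ∀ ℓ, v (α ℓ) ≤ R) (hRmem : ∃ ℓ, v (α ℓ) = R)
    (j : Fin d) (rj : ℝ)
    (hrj : rj = R / ∏ ℓ ∈ Finset.univ.erase j, v (α ℓ - α j))
    (hsmall : ∀ i, i ≠ j → rj < v (α i - α j)) :
    (∀ y : F, v y ≤ rj →
      v (∏ ℓ, (α j + y - α ℓ)) = v y * ∏ ℓ ∈ Finset.univ.erase j, v (α j - α ℓ) ∧
      v (∏ ℓ, (α j + y - α ℓ)) = (v y / rj) * R) ∧
    (IsAlgClosed F →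
      (fun x => ∏ ℓ, (x - α ℓ)) '' {x | v (x - α j) ≤ rj} = {w | v w ≤ R}) := by
  classical
  set P : ℝ := ∏ ℓ ∈ Finset.univ.erase j, v (α ℓ - α j) with hP
  have hP' : ∏ ℓ ∈ Finset.univ.erase j, v (α j - α ℓ) = P :=
    Finset.prod_congr rfl fun ℓ _ => v.map_sub _ _
  have hPpos : 0 < P := Finset.prod_pos fun ℓ hℓ =>
    v.pos (sub_ne_zero.mpr fun h => Finset.ne_of_mem_erase hℓ (hinj h))
  have hRpos : 0 < R := by
    by_contra! hR
    have h0 : ∀ ℓ, α ℓ = 0 := fun ℓ =>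
      v.eq_zero.mp (le_antisymm ((hRmax ℓ).trans hR) (v.nonneg _))
    have := hinj ((h0 ⟨0, by omega⟩).trans (h0 ⟨1, by omega⟩).symm)
    simp at this
  have hrpos : 0 < rj := hrj ▸ div_pos hRpos hPpos
  have hRP : rj * P = R := by rw [hrj]; field_simp
  have key : ∀ y : F, v y ≤ rj → v (∏ ℓ, (α j + y - α ℓ)) = v y * P := by
    intro y hy
    rw [← Finset.mul_prod_erase Finset.univ _ (Finset.mem_univ j), v.map_mul, map_prod, ← hP']
    congr 1
    · congr 1; ring
    · refine Finset.prod_congr rfl fun ℓ hℓ => ?_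
      rw [show α j + y - α ℓ = (α j - α ℓ) + y by ring]
      apply na_add_of_lt v hna
      rw [v.map_sub]
      exact hy.trans_lt (hsmall ℓ (Finset.ne_of_mem_erase hℓ))
  refine ⟨fun y hy => ⟨by rw [hP']; exact key y hy, ?_⟩, fun hF => ?_⟩
  · rw [key y hy, ← hRP]; field_simp
  ext w
  simp only [Set.mem_image, Set.mem_setOf_eq]
  constructor
  · rintro ⟨x, hx, rfl⟩
    have h := key (x - α j) hx
    rw [add_sub_cancel] at h
    rw [h, ← hRP]
    exact mul_le_mul_of_nonneg_right hx hPpos.le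
  · intro hw
    by_cases hw0 : w = 0
    · refine ⟨α j, by simpa using hrpos.le, ?_⟩
      rw [hw0]
      exact Finset.prod_eq_zero (Finset.mem_univ j) (sub_self _)
    let g : Polynomial F := Lagrange.nodal Finset.univ α - Polynomial.C w
    have hev : ∀ x, g.eval x = ∏ ℓ, (x - α ℓ) - w := fun x => by
      simp [g, Lagrange.eval_nodal]
    have hgj : g.eval (α j) = -w := by
      rw [hev, Finset.prod_eq_zero (Finset.mem_univ j) (sub_self _), zero_sub]
    have hdj : v (g.derivative.eval (α j)) = P := by
      rw [← hP', ← map_prod, ← Lagrange.eval_nodal,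
        ← Lagrange.eval_nodal_derivative_eval_node_eq (Finset.mem_univ j)]
      simp [g]
    have hgne : g.eval (α j) ≠ 0 := by rw [hgj]; simpa using hw0
    have hg0 : g ≠ 0 := by rintro h; simp [h] at hgne
    have hlog := (IsAlgClosed.splits g).eval_derivative_div_eval_of_ne_zero hgne
    by_contra! hno
    have hlt := na_multiset_sum_lt v hna rj⁻¹ (inv_pos.mpr hrpos)
      (g.roots.map fun z => 1 / (α j - z)) (by
        intro x hx
        obtain ⟨z, hz, rfl⟩ := Multiset.mem_map.mp hx
        have hz0 := (Polynomial.mem_roots hg0).mp hz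
        rw [Polynomial.IsRoot, hev, sub_eq_zero] at hz0
        have h1 : rj < v (z - α j) := by
          by_contra! h
          exact hno z h hz0
        rw [one_div, map_inv₀, v.map_sub]
        exact inv_strictAnti₀ hrpos h1)
    rw [← hlog, map_div₀, hdj, hgj, v.map_neg, div_lt_iff₀ (v.pos hw0)] at hlt
    have : rj⁻¹ * v w ≤ P := by
      rw [inv_mul_le_iff₀ hrpos, hRP]; exact hw
    linarith
end
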